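/- Let E be a vector bundle on P^m with supernatural cohomology whose Hilbert polynomial has roots z_1 > ... > z_m, and let a ≥ −z_m − m be an integer. Then the dual bundle E* is a-regular in the sense of Castelnuovo–Mumford, i.e., h^i(E*(a−i)) = 0 for all i ≥ 1. -/

import Mathlib

open MvPolynomial Finset Module

noncomputable section

/-- The standard graded polynomial ring `S = K[x_1, …, x_n]`. -/
abbrev PolyS (K : Type) [Field K] (n : ℕ) : Type := MvPolynomial (Fin n) K

/-- The `K`-subspace of homogeneous polynomials of integer degree `z`
(it is `0` if `z < 0`). -/
def homogZ (K : Type) [Field K] (n : ℕ) (z : ℤ) : Submodule K (PolyS K n) :=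
  ⨆ (_ : 0 ≤ z), MvPolynomial.homogeneousSubmodule (Fin n) K z.toNat

/-- The degree-`ℓ` piece of the graded free module `⊕ₚ S(-dg p)`. -/
def freePiece {K : Type} [Field K] {n r : ℕ} (dg : Fin r → ℤ) (ℓ : ℤ) :
    Submodule K (Fin r → PolyS K n) :=
  Submodule.pi Set.univ fun p => homogZ K n (ℓ - dg p)

/-- A (homologically indexed) finite complex of graded free `S`-modules
`F₀ ← F₁ ← ⋯ ← F_len ← 0`, where `Fᵢ = ⊕ₚ S(-deg i p)` and the (degree `0`)
map `Fᵢ₊₁ → Fᵢ` is given by the matrix `dd i`, whose entries are homogeneous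
of the appropriate degrees. -/
structure FreeComplex (K : Type) [Field K] (n : ℕ) where
  len : ℕ
  rk : ℕ → ℕ
  deg : (i : ℕ) → Fin (rk i) → ℤ
  dd : (i : ℕ) → Matrix (Fin (rk i)) (Fin (rk (i+1))) (PolyS K n)
  rk_eq_zero : ∀ i, len < i → rk i = 0
  isHomog : ∀ i p q, dd i p q ∈ homogZ K n (deg (i+1) q - deg i p)
  isComplex : ∀ i, dd i * dd (i+1) = 0

variable {K : Type} [Field K] {n : ℕ}

/-- `F` is exact in positive homological degrees; that is, it is a graded free
resolution of the finitely generated graded module `M = coker (F₁ → F₀)`. -/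
def IsResolution (F : FreeComplex K n) : Prop :=
  ∀ i, LinearMap.ker ((F.dd i).mulVecLin) = LinearMap.range ((F.dd (i+1)).mulVecLin)

/-- The complex is minimal: entries of the differentials lie in the maximal ideal,
i.e. all (constant) entries between generators of equal degrees vanish. -/
def IsMinimal (F : FreeComplex K n) : Prop :=
  ∀ i p q, F.deg (i+1) q = F.deg i p → F.dd i p q = 0

/-- Betti number `β_{i,j}`: the number of generators of `Fᵢ` of degree `j`. -/
def bettiNum (F : FreeComplex K n) (i : ℕ) (j : ℤ) : ℕ :=
  (Finset.univ.filter fun p => F.deg i p = j).card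

/-- The dimension of the degree-`ℓ` piece of the module `M = coker (F₁ → F₀)`
resolved by `F`. -/
def MPieceDim (F : FreeComplex K n) (ℓ : ℤ) : ℕ :=
  finrank K ((freePiece (F.deg 0) ℓ) ⧸
    (Submodule.comap (freePiece (F.deg 0) ℓ).subtype
      ((LinearMap.range ((F.dd 0).mulVecLin)).restrictScalars K)))

/-- The Hilbert polynomial of the twisted free module `S(-a)` in `n` variables:
`binom (t - a + n - 1, n - 1)`. -/
def genHilb (n : ℕ) (a : ℤ) : Polynomial ℚ :=
  if n = 0 then 0 else
    Polynomial.C (((n - 1).factorial : ℚ))⁻¹ *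
      ∏ k ∈ Finset.range (n - 1),
        (Polynomial.X - Polynomial.C (a : ℚ) + Polynomial.C ((k : ℚ) + 1))

/-- The Hilbert polynomial of `M = coker (F₁ → F₀)`, computed from the free
resolution `F` by additivity. -/
def hilbPoly (F : FreeComplex K n) : Polynomial ℚ :=
  ∑ i ∈ Finset.range (F.len + 1),
    Polynomial.C ((-1 : ℚ) ^ i) * ∑ p : Fin (F.rk i), genHilb n (F.deg i p)

/-- The Krull dimension of a module read off from its Hilbert polynomial:
`0` for the zero polynomial (finite length), `deg + 1` otherwise. -/
def polyDim (P : Polynomial ℚ) : ℕ := if P = 0 then 0 else P.natDegree + 1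

/-- `M = coker (F₁ → F₀)` is a Cohen-Macaulay module of codimension `c`:
`F` is a minimal free resolution of length exactly `c` (so `pd M = c`, and by
Auslander–Buchsbaum `depth M = n - c`) and `dim M = n - c`. -/
def IsCMcodim (F : FreeComplex K n) (c : ℕ) : Prop :=
  IsResolution F ∧ IsMinimal F ∧ (∀ i, c < i → F.rk i = 0) ∧ F.rk c ≠ 0 ∧
    polyDim (hilbPoly F) = n - c

/-- The multiplicity `e(M)` of a module of codimension `c`, computed from the
Betti numbers of a free resolution:
`e(M) = ((-1)^c / c!) ⬝ Σ_{i,j} (-1)^i β_{i,j} j^c`. -/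
def multQ (F : FreeComplex K n) (c : ℕ) : ℚ :=
  ((-1 : ℚ) ^ c / c.factorial) *
    ∑ i ∈ Finset.range (F.len + 1),
      (-1 : ℚ) ^ i * ∑ p : Fin (F.rk i), ((F.deg i p : ℚ)) ^ c


/-- A (cohomologically indexed) finite complex of graded free `S`-modules
`0 → E⁰ → E¹ → ⋯ → E^len → 0`, where `Eⁱ = ⊕ₚ S(-deg i p)` and the (degree `0`)
map `Eⁱ → Eⁱ⁺¹` is given by the matrix `dd i`. -/
structure CoComplex (K : Type) [Field K] (n : ℕ) where
  len : ℕ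
  rk : ℕ → ℕ
  deg : (i : ℕ) → Fin (rk i) → ℤ
  dd : (i : ℕ) → Matrix (Fin (rk (i+1))) (Fin (rk i)) (PolyS K n)
  rk_eq_zero : ∀ i, len < i → rk i = 0
  isHomog : ∀ i p q, dd i p q ∈ homogZ K n (deg i q - deg (i+1) p)
  isComplex : ∀ i, dd (i+1) * dd i = 0

/-- The degree-`ℓ` part of the cocycles at cohomological position `i`. -/
def CoComplex.kerPiece (E : CoComplex K n) (i : ℕ) (ℓ : ℤ) :
    Submodule K (Fin (E.rk i) → PolyS K n) :=
  ((LinearMap.ker ((E.dd i).mulVecLin)).restrictScalars K) ⊓ freePiece (E.deg i) ℓ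

/-- The coboundaries at cohomological position `i` (as a `K`-subspace). -/
def CoComplex.imSub (E : CoComplex K n) : (i : ℕ) → Submodule K (Fin (E.rk i) → PolyS K n)
  | 0 => ⊥
  | (j+1) => (LinearMap.range ((E.dd j).mulVecLin)).restrictScalars K

/-- `dim_K (Hⁱ(E))_ℓ`, the dimension of the degree-`ℓ` component of the `i`-th
cohomology module of the complex `E`. -/
def cohomDim (E : CoComplex K n) (i : ℕ) (ℓ : ℤ) : ℕ :=
  finrank K ((E.kerPiece i ℓ) ⧸
    (Submodule.comap (E.kerPiece i ℓ).subtype (E.imSub i)))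

/-- The bilinear pairing `⟨F, E⟩ = Σ_{j ≤ i, k} (-1)^{i-j} β_{i,k}(F) ⬝ dim_K (H^j E)_{-k}`
of a free resolution `F` against a free cocomplex `E`. -/
def pairing (F : FreeComplex K n) (E : CoComplex K n) : ℤ :=
  ∑ i ∈ Finset.range (F.len + 1), ∑ j ∈ Finset.range (i + 1),
    (-1 : ℤ) ^ (i - j) * ∑ p : Fin (F.rk i), (cohomDim E j (-(F.deg i p)) : ℤ)

/-- The modified pairing `⟨F, E⟩_{c,τ}`: terms with `j ≤ i` are kept when `j < τ`
or `j ≤ i - 2`, and the terms with `j = τ`, `i = τ + ε` (`ε ∈ {0,1}`) are kept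
only when the degree `k` of the generator satisfies `k ≤ c + ε`. -/
def pairingMod (F : FreeComplex K n) (E : CoComplex K n) (c : ℤ) (τ : ℕ) : ℤ :=
  (∑ i ∈ Finset.range (F.len + 1), ∑ j ∈ Finset.range (i + 1),
    if j < τ ∨ j + 2 ≤ i then
      (-1 : ℤ) ^ (i - j) * ∑ p : Fin (F.rk i), (cohomDim E j (-(F.deg i p)) : ℤ)
    else 0) +
  ∑ ε ∈ Finset.range 2,
    (-1 : ℤ) ^ ε * ∑ p ∈ Finset.univ.filter (fun p => F.deg (τ + ε) p ≤ c + ε),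
      (cohomDim E τ (-(F.deg (τ + ε) p)) : ℤ)

/-- The dual cocomplex `Hom(F, S)`: `0 → F₀^∨ → F₁^∨ → ⋯`. Its `j`-th cohomology
is `Ext^j_S(M, S)` for the module `M` resolved by `F`. -/
def dualCo (F : FreeComplex K n) : CoComplex K n where
  len := F.len
  rk := F.rk
  deg := fun i p => -F.deg i p
  dd := fun i => (F.dd i).transpose
  rk_eq_zero := F.rk_eq_zero
  isHomog := by
    intro i p q
    have h := F.isHomog i q p
    rw [neg_sub_neg]
    exact h
  isComplex := by
    intro i
    rw [← Matrix.transpose_mul, F.isComplex i, Matrix.transpose_zero]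

/-- `dim_K Ext^j_S(M, S)_e`, where `M = coker (F₁ → F₀)` (zero for `j < 0`). -/
def extDim (F : FreeComplex K n) (j : ℤ) (e : ℤ) : ℕ :=
  if 0 ≤ j then cohomDim (dualCo F) j.toNat e else 0

/-- `h^i(𝓔(d)) = dim_K H^i(ℙ^{n-1}, 𝓔(d))` for the coherent sheaf `𝓔 = M~` on
`ℙ^{n-1}` associated to the module `M = coker (F₁ → F₀)` resolved by `F`,
expressed via graded local duality:
`h^i(𝓔(d)) = dim Ext^{n-1-i}(M,S)_{-d-n}` for `i ≥ 1`, and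
`h^0(𝓔(d)) = dim M_d - dim Ext^{n}(M,S)_{-d-n} + dim Ext^{n-1}(M,S)_{-d-n}`. -/
def sheafH (F : FreeComplex K n) (i : ℕ) (d : ℤ) : ℕ :=
  if i = 0 then
    MPieceDim F d - extDim F (n : ℤ) (-d - n) + extDim F ((n : ℤ) - 1) (-d - n)
  else extDim F ((n : ℤ) - 1 - i) (-d - n)

/-- The ideal generated by the `s × s` minors of a matrix. -/
def minorsIdeal {a b : ℕ} (M : Matrix (Fin a) (Fin b) (PolyS K n)) (s : ℕ) :
    Ideal (PolyS K n) :=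
  Ideal.span (Set.range fun fg : (Fin s ↪ Fin a) × (Fin s ↪ Fin b) =>
    (M.submatrix fg.1 fg.2).det)

/-- The `r`-th Fitting ideal of `M = coker (F₁ → F₀)`: the ideal of
`(rk F₀ - r)`-minors of the presentation matrix. -/
def fittingIdeal (F : FreeComplex K n) (r : ℤ) : Ideal (PolyS K n) :=
  if (F.rk 0 : ℤ) - r ≤ 0 then ⊤ else minorsIdeal (F.dd 0) ((F.rk 0 : ℤ) - r).toNat

/-- The irrelevant maximal ideal `(x_1, …, x_n)` of `S`. -/
def irrel (K : Type) [Field K] (n : ℕ) : Ideal (PolyS K n) :=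
  Ideal.span (Set.range (MvPolynomial.X : Fin n → PolyS K n))

/-- The coherent sheaf `M~` on `ℙ^{n-1}` associated to `M = coker (F₁ → F₀)` is a
locally free sheaf (vector bundle) of rank `r`: the Fitting ideal `Fitt_{r-1}(M)`
is zero and `Fitt_r(M)` contains a power of the irrelevant ideal. -/
def IsVectorBundle (F : FreeComplex K n) (r : ℕ) : Prop :=
  fittingIdeal F ((r : ℤ) - 1) = ⊥ ∧ ∃ N : ℕ, (irrel K n) ^ N ≤ fittingIdeal F r

/-- The rank of a sheaf of dimension `s`: the normalized leading coefficient of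
its Hilbert polynomial, `χ(𝓔(d)) = (rank 𝓔 / s!) d^s + O(d^{s-1})`. -/
def sheafRank (F : FreeComplex K n) (s : ℕ) : ℚ :=
  (s.factorial : ℚ) * (hilbPoly F).coeff s

/-- The sheaf `M~` has natural cohomology: for each `d` at most one `h^i(𝓔(d))`
is nonzero. -/
def HasNaturalCohomology (F : FreeComplex K n) : Prop :=
  ∀ (d : ℤ) (i i' : ℕ), sheafH F i d ≠ 0 → sheafH F i' d ≠ 0 → i = i'

/-- The sheaf `𝓔 = M~` (of dimension `s`) has supernatural cohomology with root
sequence `z_1 > ⋯ > z_s`: it has natural cohomology and its Hilbert polynomial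
`d ↦ χ(𝓔(d))` has the distinct integral roots `z_1 > ⋯ > z_s`. -/
def IsSupernaturalWithRoots (F : FreeComplex K n) {s : ℕ} (z : Fin s → ℤ) : Prop :=
  StrictAnti z ∧ HasNaturalCohomology F ∧
    ∃ a : ℚ, a ≠ 0 ∧
      hilbPoly F = Polynomial.C a * ∏ i : Fin s, (Polynomial.X - Polynomial.C ((z i : ℚ)))


/-- The graded module `M = coker (F₁ → F₀)` presented by the complex `F`. -/
abbrev Mmod (F : FreeComplex K n) :=
  (Fin (F.rk 0) → PolyS K n) ⧸ LinearMap.range ((F.dd 0).mulVecLin)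

/-- The degree-`ℓ` piece of `M = coker (F₁ → F₀)` (as a `K`-subspace). -/
def MpieceIm (F : FreeComplex K n) (ℓ : ℤ) : Submodule K (Mmod F) :=
  (freePiece (F.deg 0) ℓ).map
    (((LinearMap.range ((F.dd 0).mulVecLin)).mkQ).restrictScalars K)

/-- The degree-`e` graded piece of the graded dual module `Hom_S(M, S)`; when
`M~` is a vector bundle `𝓔`, `Hom_S(M,S)~` is the dual bundle `𝓔^*`. -/
def dualPiece (F : FreeComplex K n) (e : ℤ) :
    Submodule K (Mmod F →ₗ[PolyS K n] PolyS K n) where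
  carrier := {φ | ∀ (ℓ : ℤ) v, v ∈ MpieceIm F ℓ → φ v ∈ homogZ K n (ℓ + e)}
  add_mem' := by
    intro a b ha hb ℓ v hv
    simpa using add_mem (ha ℓ v hv) (hb ℓ v hv)
  zero_mem' := by
    intro ℓ v hv
    simpa using Submodule.zero_mem _
  smul_mem' := by
    intro c a ha ℓ v hv
    simpa using Submodule.smul_mem _ c (ha ℓ v hv)

/-! ### Laurent polynomials and supports -/

/-- Laurent polynomials in `n` variables. -/
abbrev Lau (K : Type) [Field K] (n : ℕ) : Type := AddMonoidAlgebra K (Fin n → ℤ)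

/-- Exponent embedding `ℕ^n → ℤ^n`. -/
def expZ (n : ℕ) : (Fin n →₀ ℕ) →+ (Fin n → ℤ) where
  toFun b := fun i => (b i : ℤ)
  map_zero' := by ext; simp
  map_add' := by intro a b; ext; simp

lemma expZ_apply (b : Fin n →₀ ℕ) (i : Fin n) : expZ n b i = (b i : ℤ) := rfl

lemma expZ_inj : Function.Injective (expZ n) := by
  intro a b h
  ext i
  have := congrFun h i
  simpa [expZ_apply] using this

/-- The inclusion of polynomials in Laurent polynomials. -/
def toL : PolyS K n →ₐ[K] Lau K n := AddMonoidAlgebra.mapDomainAlgHom K K (expZ n)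

lemma toL_apply (f : PolyS K n) :
    toL f = AddMonoidAlgebra.mapDomain (expZ n) f := rfl

lemma toL_inj : Function.Injective (toL : PolyS K n →ₐ[K] Lau K n) :=
  AddMonoidAlgebra.mapDomain_injective expZ_inj

lemma coeff_toL (f : PolyS K n) (b : Fin n →₀ ℕ) :
    (toL f).coeff (expZ n b) = f.coeff b :=
  Finsupp.mapDomain_apply expZ_inj _ _

lemma coeff_toL_of_notMem (f : PolyS K n) (a : Fin n → ℤ) (h : a ∉ Set.range (expZ n)) :
    (toL f).coeff a = 0 :=
  Finsupp.mapDomain_of_notMem_range _ _ h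

lemma mem_range_expZ (a : Fin n → ℤ) : a ∈ Set.range (expZ n) ↔ ∀ i, 0 ≤ a i := by
  constructor
  · rintro ⟨b, rfl⟩ i
    simp [expZ_apply]
  · intro h
    refine ⟨Finsupp.equivFunOnFinite.symm fun i => (a i).toNat, ?_⟩
    ext i
    simp [expZ_apply, h i]

/-- Laurent polynomials supported in the set `R` of exponents. -/
def SP (K : Type) [Field K] {n : ℕ} (R : Set (Fin n → ℤ)) : Submodule K (Lau K n) :=
  AddMonoidAlgebra.supported K K R

lemma mem_SP {R : Set (Fin n → ℤ)} {f : Lau K n} : f ∈ SP K R ↔ ∀ a, f.coeff a ≠ 0 → a ∈ R := by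
  rw [SP, AddMonoidAlgebra.mem_supported']
  exact forall_congr' fun a => by tauto

lemma SP_mono {R R' : Set (Fin n → ℤ)} (h : R ⊆ R') : SP K R ≤ SP K R' :=
  AddMonoidAlgebra.supported_mono h

lemma SP_mul {A B C : Set (Fin n → ℤ)} (h : ∀ a ∈ A, ∀ b ∈ B, a + b ∈ C) {f g : Lau K n}
    (hf : f ∈ SP K A) (hg : g ∈ SP K B) : f * g ∈ SP K C := by
  classical
  rw [mem_SP] at *
  intro c hc
  have := AddMonoidAlgebra.support_coeff_mul_subset f g (Finsupp.mem_support_iff.mpr hc)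
  obtain ⟨a, ha, b, hb, rfl⟩ := Finset.mem_add.mp this
  exact h a (hf a (Finsupp.mem_support_iff.mp ha)) b (hg b (Finsupp.mem_support_iff.mp hb))

lemma mem_homogZ {z : ℤ} {f : PolyS K n} :
    f ∈ homogZ K n z ↔ ∀ b, f.coeff b ≠ 0 → ∑ i, expZ n b i = z := by
  have key : ∀ b : Fin n →₀ ℕ, ∑ i, expZ n b i = ((b.degree : ℕ) : ℤ) := by
    intro b
    simp [expZ_apply, Finsupp.degree_eq_sum]
  simp only [key]
  unfold homogZ
  by_cases hz : 0 ≤ z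
  · simp only [hz, iSup_pos, mem_homogeneousSubmodule]
    rw [IsHomogeneous, IsWeightedHomogeneous]
    refine forall_congr' fun b => forall_congr' fun _ => ?_
    have hw : Finsupp.weight (1 : Fin n → ℕ) b = b.degree := by
      rw [Finsupp.degree_eq_weight_one]; rfl
    rw [hw]
    omega
  · simp only [hz, iSup_false, Submodule.mem_bot]
    constructor
    · rintro rfl b hb
      simp at hb
    · intro h
      ext b
      by_contra hb
      have := h b (by simpa using hb)
      omega

/-- exponents `≥ 0` -/
def Pos (n : ℕ) : Set (Fin n → ℤ) := {a | ∀ i, 0 ≤ a i}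

lemma toL_mem {z : ℤ} {f : PolyS K n} :
    toL f ∈ SP K {a | a ∈ Pos n ∧ ∑ i, a i = z} ↔ f ∈ homogZ K n z := by
  rw [mem_SP, mem_homogZ]
  constructor
  · intro h b hb
    exact (h (expZ n b) (by rwa [coeff_toL])).2
  · intro h a ha
    by_cases hr : a ∈ Set.range (expZ n)
    · obtain ⟨b, rfl⟩ := hr
      rw [coeff_toL] at ha
      exact ⟨(mem_range_expZ _).mp ⟨b, rfl⟩, h b ha⟩
    · exact absurd (coeff_toL_of_notMem f a hr) ha

lemma exists_toL {z : ℤ} {g : Lau K n} (hg : g ∈ SP K {a | a ∈ Pos n ∧ ∑ i, a i = z}) :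
    ∃ f ∈ homogZ K n z, toL f = g := by
  refine ⟨AddMonoidAlgebra.comapDomain (expZ n) expZ_inj g, ?_, ?_⟩
  · rw [← toL_mem]
    convert hg
    rw [toL_apply]
    apply AddMonoidAlgebra.mapDomain_comapDomain
    intro a ha
    rw [mem_range_expZ]
    exact (mem_SP.mp hg a (Finsupp.mem_support_iff.mp ha)).1
  · rw [toL_apply]
    apply AddMonoidAlgebra.mapDomain_comapDomain
    intro a ha
    rw [mem_range_expZ]
    exact (mem_SP.mp hg a (Finsupp.mem_support_iff.mp ha)).1

open Classical in
/-- Restriction of the support. -/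
def flt (K : Type) [Field K] {n : ℕ} (A : Set (Fin n → ℤ)) : Lau K n →ₗ[K] Lau K n where
  toFun f := .ofCoeff (f.coeff.filter (· ∈ A))
  map_add' f g := by ext; simp [Finsupp.filter_add]
  map_smul' c f := by ext; simp [Finsupp.filter_smul]

open Classical in
lemma coeff_flt (A : Set (Fin n → ℤ)) (f : Lau K n) (a : Fin n → ℤ) :
    (flt K A f).coeff a = if a ∈ A then f.coeff a else 0 := by
  simp [flt, Finsupp.filter_apply]

/-- Laurent monomial. -/
def mon (K : Type) [Field K] {n : ℕ} (g : Fin n → ℤ) : Lau K n := AddMonoidAlgebra.single g 1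

lemma mon_mem (g : Fin n → ℤ) : mon K g ∈ SP K {g} := by
  rw [mem_SP]
  intro a ha
  by_contra h
  apply ha
  simp only [mon, AddMonoidAlgebra.coeff_single]
  rw [Finsupp.single_apply, if_neg]
  exact fun h' => h h'.symm

lemma mon_mul (g h : Fin n → ℤ) : mon K g * mon K h = mon K (g + h) := by
  simp [mon, AddMonoidAlgebra.single_mul_single]

lemma mon_zero : mon K (0 : Fin n → ℤ) = 1 := rfl

/-! ### Two-sided graded free complexes -/

/-- Index set for two-sided complexes. -/
abbrev Idx := ℕ ⊕ ℕ

/-- The position before a given one. -/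
def nx : Idx → Idx
  | .inl 0 => .inr 0
  | .inl (l + 1) => .inl l
  | .inr k => .inr (k + 1)

/-- A complex of graded free modules indexed by `Idx`, with maps `C (nx s) → C s`. -/
structure GC (K : Type) [Field K] (n : ℕ) where
  rk : Idx → ℕ
  deg : (s : Idx) → Fin (rk s) → ℤ
  dd : (s : Idx) → Matrix (Fin (rk s)) (Fin (rk (nx s))) (PolyS K n)
  isHomog : ∀ s p q, dd s p q ∈ homogZ K n (deg (nx s) q - deg s p)
  isComplex : ∀ s, dd s * dd (nx s) = 0

/-- Up-closed sets of exponents. -/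
def Up (U : Set (Fin n → ℤ)) : Prop := ∀ a ∈ U, ∀ b ∈ Pos n, a + b ∈ U

/-- The dimension of `Z / (Z ∩ B)`. -/
def qdim {X : Type*} [AddCommGroup X] [Module K X] (Z B : Submodule K X) : ℕ :=
  finrank K (Z ⧸ Submodule.comap Z.subtype B)

lemma qdim_eq {X Y : Type*} [AddCommGroup X] [Module K X] [AddCommGroup Y] [Module K Y]
    (Z B : Submodule K X) (Z' B' : Submodule K Y) (f : X →ₗ[K] Y)
    (h1 : ∀ z ∈ Z, f z ∈ Z') (h2 : ∀ z ∈ Z, z ∈ B ↔ f z ∈ B')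
    (h3 : ∀ y ∈ Z', ∃ z ∈ Z, y - f z ∈ B') : qdim Z B = qdim Z' B' := by
  let g : Z →ₗ[K] Z' := f.restrict h1
  let q : Z →ₗ[K] (Z' ⧸ Submodule.comap Z'.subtype B') :=
    (Submodule.mkQ _).comp g
  have hk : LinearMap.ker q = Submodule.comap Z.subtype B := by
    ext ⟨z, hz⟩
    simp only [q, LinearMap.mem_ker, LinearMap.comp_apply, Submodule.mkQ_apply,
      Submodule.Quotient.mk_eq_zero, Submodule.mem_comap, Submodule.subtype_apply]
    exact (h2 z hz).symm
  have hs : Function.Surjective q := by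
    intro y
    obtain ⟨⟨y, hy⟩, rfl⟩ := Submodule.mkQ_surjective _ y
    obtain ⟨z, hz, hzy⟩ := h3 y hy
    refine ⟨⟨z, hz⟩, ?_⟩
    simp only [q, LinearMap.comp_apply, Submodule.mkQ_apply]
    rw [eq_comm, Submodule.Quotient.eq]
    exact hzy
  unfold qdim
  rw [← hk]
  exact (q.quotKerEquivOfSurjective hs).finrank_eq

namespace GC

variable (C : GC K n)

/-- Chains with coefficients in Laurent polynomials supported in `R`, of degree `e`. -/
def X (R : Set (Fin n → ℤ)) (s : Idx) (e : ℤ) : Submodule K (Fin (C.rk s) → Lau K n) :=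
  Submodule.pi Set.univ fun p => SP K {a | a ∈ R ∧ ∑ i, a i = e - C.deg s p}

lemma mem_X {R : Set (Fin n → ℤ)} {s : Idx} {e : ℤ} {w : Fin (C.rk s) → Lau K n} :
    w ∈ C.X R s e ↔ ∀ p a, (w p).coeff a ≠ 0 → a ∈ R ∧ ∑ i, a i = e - C.deg s p := by
  simp [X, Submodule.mem_pi, mem_SP]

lemma X_mono {R R' : Set (Fin n → ℤ)} (h : R ⊆ R') (s : Idx) (e : ℤ) :
    C.X R s e ≤ C.X R' s e := by
  intro w hw
  rw [mem_X] at *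
  exact fun p a ha => ⟨h (hw p a ha).1, (hw p a ha).2⟩

/-- The differential. -/
def bd (s : Idx) : (Fin (C.rk (nx s)) → Lau K n) →ₗ[Lau K n] (Fin (C.rk s) → Lau K n) :=
  ((C.dd s).map toL).mulVecLin

/-- The differential, `K`-linear. -/
def bdK (s : Idx) : (Fin (C.rk (nx s)) → Lau K n) →ₗ[K] (Fin (C.rk s) → Lau K n) :=
  (C.bd s).restrictScalars K

@[simp] lemma bdK_apply (s : Idx) (w) : C.bdK s w = C.bd s w := rfl

lemma bd_bd (s : Idx) (w) : C.bd s (C.bd (nx s) w) = 0 := by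
  simp only [bd, Matrix.mulVecLin_apply, Matrix.mulVec_mulVec]
  have : (C.dd s).map toL * (C.dd (nx s)).map (toL : PolyS K n → Lau K n) = 0 := by
    have h := Matrix.map_mul (L := C.dd s) (M := C.dd (nx s))
      (f := (toL : PolyS K n →ₐ[K] Lau K n).toRingHom)
    rw [C.isComplex s] at h
    rw [Matrix.map_zero _ (map_zero _)] at h
    exact h.symm
  rw [this, Matrix.zero_mulVec]

lemma bd_mem {U : Set (Fin n → ℤ)} (hU : Up U) {s : Idx} {e : ℤ}
    {w : Fin (C.rk (nx s)) → Lau K n} (hw : w ∈ C.X U (nx s) e) : C.bd s w ∈ C.X U s e := by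
  rw [X, Submodule.mem_pi] at *
  intro p _
  simp only [bd, Matrix.mulVecLin_apply, Matrix.mulVec, dotProduct]
  refine Submodule.sum_mem _ fun q _ => ?_
  refine SP_mul ?_ (toL_mem.mpr (C.isHomog s p q)) (hw q trivial)
  rintro a ⟨ha, ha'⟩ b ⟨hb, hb'⟩
  refine ⟨by rw [add_comm]; exact hU b hb a ha, ?_⟩
  simp only [Pi.add_apply, Finset.sum_add_distrib, ha', hb']
  ring

lemma mon_mem_X {R R' : Set (Fin n → ℤ)} (g : Fin n → ℤ) (h : ∀ a ∈ R, g + a ∈ R')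
    {s : Idx} {e e' : ℤ} (he : e' = e + ∑ i, g i) {w : Fin (C.rk s) → Lau K n}
    (hw : w ∈ C.X R s e) : mon K g • w ∈ C.X R' s e' := by
  rw [X, Submodule.mem_pi] at *
  intro p _
  refine SP_mul ?_ (mon_mem g) (hw p trivial)
  rintro a rfl b ⟨hb, hb'⟩
  refine ⟨h b hb, ?_⟩
  simp only [Pi.add_apply, Finset.sum_add_distrib, hb', he]
  ring

lemma mon_mon (g h : Fin n → ℤ) {s : Idx} (w : Fin (C.rk s) → Lau K n) :
    mon K g • mon K h • w = mon K (g + h) • w := by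
  rw [smul_smul, mon_mul]

lemma mon_neg_mon (g : Fin n → ℤ) {s : Idx} (w : Fin (C.rk s) → Lau K n) :
    mon K (-g) • mon K g • w = w := by
  rw [mon_mon, neg_add_cancel, mon_zero, one_smul]

/-- componentwise restriction of supports -/
def fl (A : Set (Fin n → ℤ)) (s : Idx) :
    (Fin (C.rk s) → Lau K n) →ₗ[K] (Fin (C.rk s) → Lau K n) :=
  LinearMap.pi fun p => (flt K A).comp (LinearMap.proj p)

lemma fl_apply (A : Set (Fin n → ℤ)) (s : Idx) (w) (p) : C.fl A s w p = flt K A (w p) := rfl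

lemma fl_mem {R R' : Set (Fin n → ℤ)} (A : Set (Fin n → ℤ)) (h : R ∩ A ⊆ R') {s : Idx} {e : ℤ}
    {w} (hw : w ∈ C.X R s e) : C.fl A s w ∈ C.X R' s e := by
  classical
  rw [mem_X] at *
  intro p a ha
  rw [fl_apply, coeff_flt] at ha
  split_ifs at ha with h1
  · exact ⟨h ⟨(hw p a ha).1, h1⟩, (hw p a ha).2⟩
  · exact absurd rfl ha

lemma sub_fl_mem {R R' : Set (Fin n → ℤ)} (A : Set (Fin n → ℤ)) (h : R \ A ⊆ R') {s : Idx} {e : ℤ}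
    {w} (hw : w ∈ C.X R s e) : w - C.fl A s w ∈ C.X R' s e := by
  classical
  rw [mem_X] at *
  intro p a ha
  rw [Pi.sub_apply, AddMonoidAlgebra.coeff_sub, Finsupp.sub_apply, fl_apply, coeff_flt] at ha
  split_ifs at ha with h1
  · exact absurd (sub_self _) ha
  · rw [sub_zero] at ha
    exact ⟨h ⟨(hw p a ha).1, h1⟩, (hw p a ha).2⟩

lemma X_inter {R R' : Set (Fin n → ℤ)} {s : Idx} {e : ℤ} {w} (h : w ∈ C.X R s e)
    (h' : w ∈ C.X R' s e) {R'' : Set (Fin n → ℤ)} (hR : R ∩ R' ⊆ R'') : w ∈ C.X R'' s e := by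
  rw [mem_X] at *
  exact fun p a ha => ⟨hR ⟨(h p a ha).1, (h' p a ha).1⟩, (h p a ha).2⟩

lemma X_split {R A B : Set (Fin n → ℤ)} (h : R ⊆ A ∪ B) {s : Idx} {e : ℤ} {w}
    (hw : w ∈ C.X R s e) : ∃ u ∈ C.X A s e, ∃ v ∈ C.X B s e, w = u + v :=
  ⟨C.fl A s w, C.fl_mem A (fun _ h => h.2) hw, w - C.fl A s w,
    C.sub_fl_mem A (fun x hx => (h hx.1).resolve_left hx.2) hw, by abel⟩

lemma fl_eq_zero {R : Set (Fin n → ℤ)} (A : Set (Fin n → ℤ)) (h : ∀ a ∈ R, a ∉ A) {s : Idx} {e : ℤ}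
    {w} (hw : w ∈ C.X R s e) : C.fl A s w = 0 := by
  classical
  rw [mem_X] at hw
  funext p
  ext a
  rw [fl_apply, coeff_flt]
  split_ifs with h1
  · by_contra h2
    exact h a (hw p a h2).1 h1
  · rfl

lemma fl_eq_self {R : Set (Fin n → ℤ)} (A : Set (Fin n → ℤ)) (h : R ⊆ A) {s : Idx} {e : ℤ}
    {w} (hw : w ∈ C.X R s e) : C.fl A s w = w := by
  classical
  rw [mem_X] at hw
  funext p
  ext a
  rw [fl_apply, coeff_flt]
  split_ifs with h1
  · rfl
  · by_contra h2
    exact h1 (h (hw p a (fun h3 => h2 h3.symm)).1)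

/-- relative cycles at position `nx s` -/
def Z (U V : Set (Fin n → ℤ)) (s : Idx) (e : ℤ) : Submodule K (Fin (C.rk (nx s)) → Lau K n) :=
  C.X U (nx s) e ⊓ (C.X V s e).comap (C.bdK s)

/-- relative boundaries at position `nx s` -/
def B (U V : Set (Fin n → ℤ)) (s : Idx) (e : ℤ) : Submodule K (Fin (C.rk (nx s)) → Lau K n) :=
  (C.X U (nx (nx s)) e).map (C.bdK (nx s)) ⊔ C.X V (nx s) e

lemma mem_Z {U V : Set (Fin n → ℤ)} {s : Idx} {e : ℤ} {w} :
    w ∈ C.Z U V s e ↔ w ∈ C.X U (nx s) e ∧ C.bd s w ∈ C.X V s e := Iff.rfl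

lemma mem_B {U V : Set (Fin n → ℤ)} {s : Idx} {e : ℤ} {w} :
    w ∈ C.B U V s e ↔ ∃ b ∈ C.X U (nx (nx s)) e, ∃ v ∈ C.X V (nx s) e,
      w = C.bd (nx s) b + v := by
  rw [B, Submodule.mem_sup]
  constructor
  · rintro ⟨_, ⟨b, hb, rfl⟩, v, hv, rfl⟩
    exact ⟨b, hb, v, hv, rfl⟩
  · rintro ⟨b, hb, v, hv, rfl⟩
    exact ⟨_, ⟨b, hb, rfl⟩, v, hv, rfl⟩

end GC

/-! ### Iterated connecting maps -/

/-- exponents nonnegative in the coordinates `≥ k` -/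
def Uk (n k : ℕ) : Set (Fin n → ℤ) := {a | ∀ i : Fin n, k ≤ i.val → 0 ≤ a i}

/-- elements of `Uk n k` having a nonnegative coordinate of index `< k` -/
def Vk (n k : ℕ) : Set (Fin n → ℤ) := {a | a ∈ Uk n k ∧ ∃ i : Fin n, i.val < k ∧ 0 ≤ a i}

/-- auxiliary region -/
def Vk' (n k : ℕ) : Set (Fin n → ℤ) := {a | a ∈ Uk n (k + 1) ∧ ∃ i : Fin n, i.val < k ∧ 0 ≤ a i}

lemma up_Uk (k : ℕ) : Up (Uk n k) := by
  intro a ha b hb i hi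
  have := ha i hi
  have := hb i
  simp only [Pi.add_apply]
  omega

lemma up_Vk (k : ℕ) : Up (Vk n k) := by
  rintro a ⟨ha, i, hi, hi'⟩ b hb
  refine ⟨up_Uk k a ha b hb, i, hi, ?_⟩
  have := hb i
  simp only [Pi.add_apply]
  omega

lemma up_Vk' (k : ℕ) : Up (Vk' n k) := by
  rintro a ⟨ha, i, hi, hi'⟩ b hb
  refine ⟨up_Uk _ a ha b hb, i, hi, ?_⟩
  have := hb i
  simp only [Pi.add_apply]
  omega

lemma Uk_zero : Uk n 0 = Pos n := by
  ext a
  simp [Uk, Pos]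

lemma Vk_zero : Vk n 0 = ∅ := by
  ext a
  simp [Vk]

lemma Uk_sub (k : ℕ) : Uk n k ⊆ Uk n (k + 1) := fun _ ha i hi => ha i (by omega)

lemma Vk_sub (k : ℕ) : Vk n k ⊆ Uk n k := fun _ ha => ha.1

lemma Vk'_sub (k : ℕ) : Vk' n k ⊆ Uk n (k + 1) := fun _ ha => ha.1

lemma Vk_sub' (k : ℕ) : Vk n k ⊆ Vk' n k := fun _ ha => ⟨Uk_sub k ha.1, ha.2⟩

lemma Vk'_sub_succ (k : ℕ) : Vk' n k ⊆ Vk n (k + 1) :=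
  fun _ ⟨h, i, hi, hi'⟩ => ⟨h, i, by omega, hi'⟩

lemma Uk_inter (k : Fin n) : Uk n (k + 1) ∩ {a | 0 ≤ a k} ⊆ Uk n k := by
  rintro a ⟨ha, ha'⟩ i hi
  rcases Nat.lt_or_ge k.val i.val with h | h
  · exact ha i h
  · have : i = k := Fin.ext (by omega)
    rw [this]; exact ha'

lemma Uk_sub_half (k : Fin n) : Uk n k ⊆ {a | 0 ≤ a k} := fun _ ha => ha k le_rfl

lemma Uk_sub_succ (k : Fin n) : Uk n k ⊆ Vk n (k + 1) :=
  fun _ ha => ⟨Uk_sub _ ha, k, by omega, ha k le_rfl⟩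

lemma Vk_succ_sub (k : Fin n) : Vk n (k + 1) ⊆ Uk n k ∪ Vk' n k := by
  rintro a ⟨ha, i, hi, hi'⟩
  rcases Nat.lt_or_ge i.val k.val with h | h
  · exact Or.inr ⟨ha, i, h, hi'⟩
  · have : i = k := Fin.ext (by omega)
    subst this
    exact Or.inl (Uk_inter i ⟨ha, hi'⟩)

lemma Vk_succ_diff (k : Fin n) : Vk n (k + 1) \ {a | 0 ≤ a k} ⊆ Vk' n k := by
  rintro a ⟨ha, hi'⟩
  exact (Vk_succ_sub k ha).resolve_left fun h => hi' (Uk_sub_half k h)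

lemma Vk'_inter (k : Fin n) : Vk' n k ∩ {a | 0 ≤ a k} ⊆ Vk n k := by
  rintro a ⟨⟨ha, h⟩, ha'⟩
  exact ⟨Uk_inter k ⟨ha, ha'⟩, h⟩

lemma nx_surj (s : Idx) : ∃ s', nx s' = s := by
  rcases s with l | k
  · exact ⟨.inl (l + 1), rfl⟩
  · rcases k with _ | k
    · exact ⟨.inl 0, rfl⟩
    · exact ⟨.inr k, rfl⟩

namespace GC

variable (C : GC K n)

/-- torsion of relative homology with respect to a variable -/
def Tor (U V : Set (Fin n → ℤ)) (j : Fin n) : Prop :=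
  ∀ s e z, z ∈ C.Z U V s e → ∃ t : ℕ, mon K (Pi.single j (t : ℤ)) • z ∈ C.B U V s (e + t)

/-- dimension of relative homology -/
def hU (U V : Set (Fin n → ℤ)) (s : Idx) (e : ℤ) : ℕ := qdim (C.Z U V s e) (C.B U V s e)

lemma exists_shift {k : Fin n} {R R' : Set (Fin n → ℤ)}
    (hR : ∀ a ∈ R, ∀ t : ℕ, 0 ≤ a k + t → Pi.single k (t : ℤ) + a ∈ R') {s : Idx} {e : ℤ}
    {w} (hw : w ∈ C.X R s e) : ∃ t0 : ℕ, ∀ t : ℕ, t0 ≤ t →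
      mon K (Pi.single k (t : ℤ)) • w ∈ C.X R' s (e + t) := by
  classical
  let S : Finset (Fin n → ℤ) := Finset.univ.biUnion fun p => (w p).coeff.support
  refine ⟨∑ a ∈ S, (a k).natAbs, fun t ht => ?_⟩
  have h1 : w ∈ C.X {a | a ∈ R ∧ 0 ≤ a k + t} s e := by
    rw [mem_X] at *
    intro p a ha
    refine ⟨⟨(hw p a ha).1, ?_⟩, (hw p a ha).2⟩
    have hm : a ∈ S := Finset.mem_biUnion.mpr ⟨p, Finset.mem_univ _, Finsupp.mem_support_iff.mpr ha⟩
    have := Finset.single_le_sum (f := fun a : Fin n → ℤ => (a k).natAbs) (fun _ _ => Nat.zero_le _) hm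
    have h2 : (a k).natAbs ≤ t := this.trans ht
    omega
  refine C.mon_mem_X _ (fun a ha => hR a ha.1 t ha.2) ?_ h1
  simp

lemma loc_exact (k : Fin n) (hT : C.Tor (Uk n k) (Vk n k) k) {s : Idx} {e : ℤ} {z}
    (hz : z ∈ C.Z (Uk n (k + 1)) (Vk' n k) s e) : z ∈ C.B (Uk n (k + 1)) (Vk' n k) s e := by
  rw [mem_Z] at hz
  have hUU : ∀ a ∈ Uk n (k + 1), ∀ t : ℕ, 0 ≤ a k + t → Pi.single k (t : ℤ) + a ∈ Uk n k := by
    intro a ha t ht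
    refine Uk_inter k ⟨?_, by simpa [add_comm] using ht⟩
    rw [add_comm (Pi.single k (t : ℤ)) a]
    refine up_Uk _ a ha _ fun i => ?_
    by_cases h : i = k
    · subst h; simp
    · simp [h]
  have hVV : ∀ a ∈ Vk' n k, ∀ t : ℕ, 0 ≤ a k + t → Pi.single k (t : ℤ) + a ∈ Vk n k := by
    rintro a ⟨ha, i, hi, hi'⟩ t ht
    refine ⟨hUU a ha t ht, i, hi, ?_⟩
    have : i ≠ k := fun h => by subst h; omega
    simpa [this] using hi'
  obtain ⟨t1, h1⟩ := C.exists_shift hUU hz.1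
  obtain ⟨t2, h2⟩ := C.exists_shift hVV hz.2
  let t := max t1 t2
  have hz' : mon K (Pi.single k (t : ℤ)) • z ∈ C.Z (Uk n k) (Vk n k) s (e + t) := by
    rw [mem_Z]
    refine ⟨h1 t (le_max_left _ _), ?_⟩
    rw [map_smul]
    exact h2 t (le_max_right _ _)
  obtain ⟨u, hu⟩ := hT _ _ _ hz'
  rw [mem_B] at hu
  obtain ⟨b, hb, v, hv, hbv⟩ := hu
  have hsum : e = e + t + u + ∑ i, (Pi.single k (-(t : ℤ) - u) : Fin n → ℤ) i := by
    simp
  rw [mem_B]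
  refine ⟨mon K (Pi.single k (-(t : ℤ) - u)) • b, C.mon_mem_X _ ?_ hsum hb,
    mon K (Pi.single k (-(t : ℤ) - u)) • v, C.mon_mem_X _ ?_ hsum hv, ?_⟩
  · intro a ha i hi
    have : i ≠ k := fun h => by subst h; omega
    simpa [this] using ha i (by omega)
  · rintro a ⟨ha, i, hi, hi'⟩
    refine ⟨?_, i, hi, ?_⟩
    · intro i hi
      have : i ≠ k := fun h => by subst h; omega
      simpa [this] using ha i (by omega)
    · have : i ≠ k := fun h => by subst h; omega
      simpa [this] using hi'
  · rw [map_smul, ← smul_add, ← hbv, mon_mon, mon_mon]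
    rw [← Pi.single_add, ← Pi.single_add]
    have : (-(t : ℤ) - u + u + t) = 0 := by ring
    rw [this, Pi.single_zero, mon_zero, one_smul]

/-- connecting map -/
def phi (k : Fin n) (s : Idx) : (Fin (C.rk (nx s)) → Lau K n) →ₗ[K] (Fin (C.rk s) → Lau K n) :=
  (C.fl {a | 0 ≤ a k} s).comp (C.bdK s)

lemma phi_apply (k : Fin n) (s : Idx) (w) : C.phi k s w = C.fl {a | 0 ≤ a k} s (C.bd s w) := rfl

lemma phi_Z (k : Fin n) {s : Idx} {e : ℤ} {c}
    (hc : c ∈ C.Z (Uk n (k + 1)) (Vk n (k + 1)) (nx s) e) :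
    C.phi k (nx s) c ∈ C.Z (Uk n k) (Vk n k) s e := by
  rw [mem_Z] at *
  have hU : C.phi k (nx s) c ∈ C.X (Uk n k) (nx s) e :=
    C.fl_mem _ (fun a ha => Uk_inter k ⟨ha.1.1, ha.2⟩) hc.2
  refine ⟨hU, ?_⟩
  have h1 : C.bd (nx s) c - C.phi k (nx s) c ∈ C.X (Vk' n k) (nx s) e :=
    C.sub_fl_mem _ (Vk_succ_diff k) hc.2
  have h2 := C.bd_mem (up_Vk' k) h1
  rw [map_sub, bd_bd, zero_sub, Submodule.neg_mem_iff] at h2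
  refine C.X_inter h2 (C.bd_mem (up_Uk k) hU) fun a ha => Vk'_inter k ⟨ha.1, Uk_sub_half k ha.2⟩

lemma phi_B (k : Fin n) (hT : C.Tor (Uk n k) (Vk n k) k) {s : Idx} {e : ℤ} {c}
    (hc : c ∈ C.Z (Uk n (k + 1)) (Vk n (k + 1)) (nx s) e) :
    c ∈ C.B (Uk n (k + 1)) (Vk n (k + 1)) (nx s) e ↔
    C.phi k (nx s) c ∈ C.B (Uk n k) (Vk n k) s e := by
  constructor
  · intro h
    obtain ⟨b, hb, w, hw, rfl⟩ := C.mem_B.mp h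
    obtain ⟨u, hu, v, hv, rfl⟩ := C.X_split (Vk_succ_sub k) hw
    rw [mem_B]
    refine ⟨u, hu, C.phi k (nx s) v, C.fl_mem _ (Vk'_inter k) (C.bd_mem (up_Vk' k) hv), ?_⟩
    rw [map_add, map_add, phi_apply, bd_bd, map_zero, zero_add, phi_apply,
      C.fl_eq_self _ (Uk_sub_half k) (C.bd_mem (up_Uk k) hu)]
  · intro h
    obtain ⟨b, hb, v, hv, hbv⟩ := C.mem_B.mp h
    have h1 : C.bd (nx s) c - C.phi k (nx s) c ∈ C.X (Vk' n k) (nx s) e :=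
      C.sub_fl_mem _ (Vk_succ_diff k) hc.2
    have h2 : c - b ∈ C.Z (Uk n (k + 1)) (Vk' n k) (nx s) e := by
      rw [mem_Z]
      refine ⟨Submodule.sub_mem _ hc.1 (C.X_mono (Uk_sub _) _ _ hb), ?_⟩
      have : C.bd (nx s) (c - b) = (C.bd (nx s) c - C.phi k (nx s) c) + v := by
        rw [map_sub, hbv]; abel
      rw [this]
      exact Submodule.add_mem _ h1 (C.X_mono (Vk_sub' _) _ _ hv)
    obtain ⟨b', hb', v', hv', h3⟩ := C.mem_B.mp (C.loc_exact k hT h2)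
    rw [mem_B]
    refine ⟨b', hb', b + v', Submodule.add_mem _ (C.X_mono (Uk_sub_succ k) _ _ hb)
      (C.X_mono (Vk'_sub_succ k) _ _ hv'), ?_⟩
    rw [sub_eq_iff_eq_add] at h3
    rw [h3]; abel

lemma phi_surj (k : Fin n) (hT : C.Tor (Uk n k) (Vk n k) k) {s : Idx} {e : ℤ} {a}
    (ha : a ∈ C.Z (Uk n k) (Vk n k) s e) :
    ∃ c ∈ C.Z (Uk n (k + 1)) (Vk n (k + 1)) (nx s) e,
      a - C.phi k (nx s) c ∈ C.B (Uk n k) (Vk n k) s e := by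
  have h1 : a ∈ C.Z (Uk n (k + 1)) (Vk' n k) s e :=
    ⟨C.X_mono (Uk_sub _) _ _ ha.1, C.X_mono (Vk_sub' _) _ _ ha.2⟩
  obtain ⟨b, hb, v, hv, h3⟩ := C.mem_B.mp (C.loc_exact k hT h1)
  have h4 : C.bd (nx s) b = a - v := by rw [h3]; abel
  refine ⟨b, ?_, ?_⟩
  · rw [mem_Z]
    refine ⟨hb, ?_⟩
    rw [h4]
    exact Submodule.sub_mem _ (C.X_mono (Uk_sub_succ k) _ _ ha.1) (C.X_mono (Vk'_sub_succ k) _ _ hv)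
  · rw [phi_apply, h4, map_sub, C.fl_eq_self _ (Uk_sub_half k) ha.1, sub_sub_cancel, mem_B]
    exact ⟨0, Submodule.zero_mem _, _, C.fl_mem _ (Vk'_inter k) hv, by rw [map_zero, zero_add]⟩

lemma hU_step (k : Fin n) (hT : C.Tor (Uk n k) (Vk n k) k) (s : Idx) (e : ℤ) :
    C.hU (Uk n (k + 1)) (Vk n (k + 1)) (nx s) e = C.hU (Uk n k) (Vk n k) s e :=
  qdim_eq _ _ _ _ (C.phi k (nx s)) (fun _ h => C.phi_Z k h) (fun _ h => C.phi_B k hT h)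
    (fun _ h => C.phi_surj k hT h)

lemma fl_mon (k j : Fin n) (hj : j ≠ k) (t : ℤ) {s : Idx} (w) :
    C.fl {a | 0 ≤ a k} s (mon K (Pi.single j t) • w) =
      mon K (Pi.single j t) • C.fl {a | 0 ≤ a k} s w := by
  classical
  funext p
  ext a
  have h1 : ∀ f : Lau K n, (mon K (Pi.single j t) * f).coeff a = f.coeff (-Pi.single j t + a) := by
    intro f
    rw [mon, AddMonoidAlgebra.coeff_single_mul_apply]
    simp
  rw [fl_apply, coeff_flt, Pi.smul_apply, Pi.smul_apply, smul_eq_mul, smul_eq_mul, h1, h1,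
    fl_apply, coeff_flt]
  simp [hj.symm]

lemma Tor_step (k j : Fin n) (hj : k < j) (hT : C.Tor (Uk n k) (Vk n k) k)
    (hTj : C.Tor (Uk n k) (Vk n k) j) : C.Tor (Uk n (k + 1)) (Vk n (k + 1)) j := by
  intro s e z hz
  obtain ⟨s, rfl⟩ := nx_surj s
  obtain ⟨t, ht⟩ := hTj _ _ _ (C.phi_Z k hz)
  refine ⟨t, ?_⟩
  have hp : ∀ i, (0 : ℤ) ≤ (Pi.single j (t : ℤ) : Fin n → ℤ) i := by
    intro i
    by_cases h : i = j
    · subst h; simp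
    · simp [h]
  rw [C.phi_B k hT]
  · rw [phi_apply, map_smul, fl_mon _ _ _ hj.ne']
    exact ht
  · rw [mem_Z] at *
    refine ⟨C.mon_mem_X _ ?_ (by simp) hz.1, ?_⟩
    · intro a ha; rw [add_comm (Pi.single j (t : ℤ)) a]; exact up_Uk _ a ha _ hp
    · rw [map_smul]
      refine C.mon_mem_X _ ?_ (by simp) hz.2
      intro a ha; rw [add_comm (Pi.single j (t : ℤ)) a]; exact up_Vk _ a ha _ hp

lemma hU_iter (hT : ∀ j, C.Tor (Pos n) ∅ j) (k : ℕ) (hk : k ≤ n) :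
    (∀ j : Fin n, k ≤ j.val → C.Tor (Uk n k) (Vk n k) j) ∧
    ∀ s e, C.hU (Uk n k) (Vk n k) (nx^[k] s) e = C.hU (Pos n) ∅ s e := by
  induction k with
  | zero =>
    rw [Uk_zero, Vk_zero]
    exact ⟨fun j _ => hT j, fun s e => rfl⟩
  | succ k ih =>
    obtain ⟨h1, h2⟩ := ih (by omega)
    have h3 := h1 ⟨k, hk⟩ le_rfl
    refine ⟨fun j hj => C.Tor_step ⟨k, hk⟩ j (Fin.mk_lt_of_lt_val hj) h3 (h1 j (by omega)), ?_⟩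
    intro s e
    rw [Function.iterate_succ_apply']
    exact (C.hU_step ⟨k, hk⟩ h3 _ e).trans (h2 s e)

end GC

/-! ### Polynomial homology -/

lemma flt_eq_self {R A : Set (Fin n → ℤ)} (h : R ⊆ A) {f : Lau K n} (hf : f ∈ SP K R) :
    flt K A f = f := by
  classical
  rw [mem_SP] at hf
  ext a
  rw [coeff_flt]
  split_ifs with h1
  · rfl
  · by_contra h2
    exact h1 (h (hf a (fun h3 => h2 h3.symm)))

lemma flt_eq_zero {R A : Set (Fin n → ℤ)} (h : ∀ a ∈ R, a ∉ A) {f : Lau K n} (hf : f ∈ SP K R) :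
    flt K A f = 0 := by
  classical
  rw [mem_SP] at hf
  ext a
  rw [coeff_flt]
  split_ifs with h1
  · by_contra h2
    exact h a (hf a h2) h1
  · rfl

lemma flt_mem {R : Set (Fin n → ℤ)} (A : Set (Fin n → ℤ)) {f : Lau K n} (hf : f ∈ SP K R) :
    flt K A f ∈ SP K {a | a ∈ R ∧ a ∈ A} := by
  classical
  rw [mem_SP] at *
  intro a ha
  rw [coeff_flt] at ha
  split_ifs at ha with h1
  · exact ⟨hf a ha, h1⟩
  · exact absurd rfl ha

lemma sub_flt_mem (A : Set (Fin n → ℤ)) (f : Lau K n) :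
    f - flt K A f ∈ SP K {a | a ∉ A} := by
  classical
  rw [mem_SP] at *
  intro a ha h1
  rw [AddMonoidAlgebra.coeff_sub, Finsupp.sub_apply, coeff_flt, if_pos h1] at ha
  exact ha (sub_self _)

lemma flt_deg_mul {a z z' : ℤ} {f : Lau K n} (hf : f ∈ SP K {b | b ∈ Pos n ∧ ∑ i, b i = a})
    (hz : z = a + z') (g : Lau K n) :
    flt K {b | ∑ i, b i = z} (f * g) = f * flt K {b | ∑ i, b i = z'} g := by
  have h0 : g = flt K {b | ∑ i, b i = z'} g + (g - flt K {b | ∑ i, b i = z'} g) := by abel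
  have h1 : f * flt K {b | ∑ i, b i = z'} g ∈ SP K {b | ∑ i, b i = z} := by
    refine SP_mul ?_ hf (flt_mem {b | ∑ i, b i = z'} (R := Set.univ) (mem_SP.mpr fun _ _ => trivial))
    rintro b ⟨_, hb⟩ c ⟨_, hc⟩
    simp only [Set.mem_ofPred_eq] at *
    simp only [Pi.add_apply, Finset.sum_add_distrib, hb, hc, hz]
  have h2 : f * (g - flt K {b | ∑ i, b i = z'} g) ∈ SP K {b | ∑ i, b i ≠ z} := by
    refine SP_mul ?_ hf (sub_flt_mem {b | ∑ i, b i = z'} g)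
    rintro b ⟨_, hb⟩ c hc
    simp only [Set.mem_ofPred_eq] at *
    simp only [Pi.add_apply, Finset.sum_add_distrib, hb, hz]
    omega
  conv_lhs => rw [h0]
  rw [mul_add, map_add, flt_eq_self subset_rfl h1, flt_eq_zero (A := {b | ∑ i, b i = z}) (fun _ h => h) h2, add_zero]

lemma toL_mem_Pos (f : PolyS K n) : toL f ∈ SP K (Pos n) := by
  rw [mem_SP]
  intro a ha
  by_contra h
  exact ha (coeff_toL_of_notMem f a fun h' => h ((mem_range_expZ _).mp h'))

lemma exists_homog_comp {r r' : ℕ} (dp : Fin r → ℤ) (dq : Fin r' → ℤ)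
    (A : Matrix (Fin r) (Fin r') (PolyS K n)) (hA : ∀ p q, A p q ∈ homogZ K n (dq q - dp p))
    {e : ℤ} {v : Fin r → PolyS K n} (hv : v ∈ freePiece dp e) (w : Fin r' → PolyS K n)
    (hw : A.mulVec w = v) : ∃ w' ∈ freePiece dq e, A.mulVec w' = v := by
  have h1 : ∀ q, ∃ f ∈ homogZ K n (e - dq q),
      toL f = flt K {b | ∑ i, b i = e - dq q} (toL (w q)) := fun q =>
    exists_toL (flt_mem {b | ∑ i, b i = e - dq q} (toL_mem_Pos (w q)))
  choose w' hw' hw'' using h1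
  refine ⟨w', fun q _ => hw' q, ?_⟩
  funext p
  apply toL_inj
  have h2 : toL (v p) = flt K {b | ∑ i, b i = e - dp p} (toL (v p)) :=
    (flt_eq_self (fun _ h => h.2) (toL_mem.mpr (hv p trivial))).symm
  rw [h2, ← hw]
  simp only [Matrix.mulVec, dotProduct, map_sum, map_mul]
  refine Finset.sum_congr rfl fun q _ => ?_
  rw [hw'', flt_deg_mul (z' := e - dq q) (toL_mem.mpr (hA p q)) (by ring)]

instance homogZ_finite (z : ℤ) : FiniteDimensional K (homogZ K n z) := by
  by_cases hz : 0 ≤ z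
  · have h : homogZ K n z = homogeneousSubmodule (Fin n) K z.toNat := by
      simp only [homogZ, hz, iSup_pos]
    rw [h]
    exact Module.Finite.iff_fg.mpr (homogeneousSubmodule_fg _ _ _)
  · have h : homogZ K n z = ⊥ := by
      simp only [homogZ, hz, iSup_false]
    rw [h]
    infer_instance

lemma mem_freePiece {r : ℕ} {dg : Fin r → ℤ} {e : ℤ} {v : Fin r → PolyS K n} :
    v ∈ freePiece dg e ↔ ∀ p, v p ∈ homogZ K n (e - dg p) := by
  simp [freePiece, Submodule.mem_pi]

/-- the free piece as a product -/
def freePieceEquiv {r : ℕ} (dg : Fin r → ℤ) (e : ℤ) :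
    (freePiece dg e : Submodule K (Fin r → PolyS K n)) ≃ₗ[K] (∀ p, homogZ K n (e - dg p)) where
  toFun v := fun p => ⟨v.1 p, v.2 p trivial⟩
  invFun v := ⟨fun p => (v p).1, fun p _ => (v p).2⟩
  left_inv v := rfl
  right_inv v := rfl
  map_add' v w := rfl
  map_smul' c v := rfl

instance freePiece_finite {r : ℕ} (dg : Fin r → ℤ) (e : ℤ) :
    FiniteDimensional K (freePiece dg e : Submodule K (Fin r → PolyS K n)) :=
  (freePieceEquiv dg e).symm.finiteDimensional

/-- componentwise embedding in Laurent polynomials -/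
def toLv (r : ℕ) : (Fin r → PolyS K n) →ₗ[K] (Fin r → Lau K n) :=
  LinearMap.pi fun p => (toL : PolyS K n →ₐ[K] Lau K n).toLinearMap.comp (LinearMap.proj p)

lemma toLv_apply (r : ℕ) (v : Fin r → PolyS K n) (p) : toLv r v p = toL (v p) := rfl

lemma toLv_inj (r : ℕ) : Function.Injective (toLv r : (Fin r → PolyS K n) →ₗ[K] _) := by
  intro v w h
  funext p
  exact toL_inj (congrFun h p)

namespace GC

variable (C : GC K n)

lemma toLv_mem {s : Idx} {e : ℤ} {v : Fin (C.rk s) → PolyS K n} :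
    toLv _ v ∈ C.X (Pos n) s e ↔ v ∈ freePiece (C.deg s) e := by
  rw [X, Submodule.mem_pi, mem_freePiece]
  exact ⟨fun h p => toL_mem.mp (h p trivial), fun h p _ => toL_mem.mpr (h p)⟩

lemma exists_toLv {s : Idx} {e : ℤ} {w} (hw : w ∈ C.X (Pos n) s e) :
    ∃ v ∈ freePiece (C.deg s) e, toLv _ v = w := by
  rw [X, Submodule.mem_pi] at hw
  choose v hv hv' using fun p => exists_toL (hw p trivial)
  exact ⟨v, fun p _ => hv p, funext hv'⟩

lemma bd_toLv (s : Idx) (v : Fin (C.rk (nx s)) → PolyS K n) :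
    C.bd s (toLv _ v) = toLv _ ((C.dd s).mulVec v) := by
  funext p
  simp only [bd, Matrix.mulVecLin_apply, Matrix.mulVec, dotProduct, toLv_apply, map_sum, map_mul,
    Matrix.map_apply]

/-- polynomial cycles -/
def ZS (s : Idx) (e : ℤ) : Submodule K (Fin (C.rk (nx s)) → PolyS K n) :=
  (LinearMap.ker (C.dd s).mulVecLin).restrictScalars K ⊓ freePiece (C.deg (nx s)) e

/-- polynomial boundaries -/
def BS (s : Idx) : Submodule K (Fin (C.rk (nx s)) → PolyS K n) :=
  (LinearMap.range (C.dd (nx s)).mulVecLin).restrictScalars K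

/-- dimension of the homology at position `nx s` -/
def hS (s : Idx) (e : ℤ) : ℕ := qdim (C.ZS s e) (C.BS s)

lemma mem_ZS {s : Idx} {e : ℤ} {v} :
    v ∈ C.ZS s e ↔ (C.dd s).mulVec v = 0 ∧ v ∈ freePiece (C.deg (nx s)) e := Iff.rfl

lemma mem_BS {s : Idx} {v} : v ∈ C.BS s ↔ ∃ w, (C.dd (nx s)).mulVec w = v := Iff.rfl

lemma X_empty {s : Idx} {e : ℤ} {w} : w ∈ C.X ∅ s e ↔ w = 0 := by
  rw [mem_X]
  constructor
  · intro h
    funext p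
    ext a
    by_contra h'
    exact (h p a h').1
  · rintro rfl p a h
    exact absurd rfl h

lemma toLv_ZS {s : Idx} {e : ℤ} {v} : toLv _ v ∈ C.Z (Pos n) ∅ s e ↔ v ∈ C.ZS s e := by
  rw [mem_Z, mem_ZS, toLv_mem, X_empty, bd_toLv, and_comm]
  refine and_congr_left fun _ => ?_
  rw [← map_zero (toLv (K := K) (n := n) _)]
  exact (toLv_inj _).eq_iff

lemma toLv_BS {s : Idx} {e : ℤ} {v} (hv : v ∈ freePiece (C.deg (nx s)) e) :
    toLv _ v ∈ C.B (Pos n) ∅ s e ↔ v ∈ C.BS s := by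
  rw [mem_B, mem_BS]
  constructor
  · rintro ⟨b, hb, w, hw, h⟩
    rw [X_empty] at hw
    obtain ⟨b, hb, rfl⟩ := C.exists_toLv hb
    rw [hw, add_zero, bd_toLv] at h
    exact ⟨b, (toLv_inj _ h).symm⟩
  · rintro ⟨w, hw⟩
    obtain ⟨w', h1, h2⟩ := exists_homog_comp _ _ _ (C.isHomog (nx s)) hv w hw
    exact ⟨toLv _ w', C.toLv_mem.mpr h1, 0, Submodule.zero_mem _, by rw [add_zero, bd_toLv, h2]⟩

lemma hU_eq_hS (s : Idx) (e : ℤ) : C.hU (Pos n) ∅ s e = C.hS s e := by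
  symm
  refine qdim_eq _ _ _ _ (toLv _) (fun z hz => C.toLv_ZS.mpr hz)
    (fun z hz => (C.toLv_BS hz.2).symm) ?_
  intro y hy
  obtain ⟨v, hv, rfl⟩ := C.exists_toLv hy.1
  exact ⟨v, C.toLv_ZS.mp hy, by rw [sub_self]; exact Submodule.zero_mem _⟩

end GC

/-! ### Duality -/

lemma qdim_add {V : Type*} [AddCommGroup V] [Module K V] [FiniteDimensional K V]
    (Z B : Submodule K V) (hBZ : B ≤ Z) : qdim Z B + finrank K B = finrank K Z := by
  have h1 := Submodule.finrank_quotient_add_finrank (Submodule.comap Z.subtype B)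
  rw [(Submodule.comapSubtypeEquivOfLe hBZ).finrank_eq] at h1
  exact h1

lemma qdim_dual {P0 P1 P2 : Type*} [AddCommGroup P0] [Module K P0] [AddCommGroup P1] [Module K P1]
    [AddCommGroup P2] [Module K P2] [FiniteDimensional K P0] [FiniteDimensional K P1]
    [FiniteDimensional K P2] (f : P0 →ₗ[K] P1) (g : P1 →ₗ[K] P2) (h : g.comp f = 0) :
    qdim (LinearMap.ker g) (LinearMap.range f) =
      qdim (LinearMap.ker f.dualMap) (LinearMap.range g.dualMap) := by
  have h1 := qdim_add (LinearMap.ker g) (LinearMap.range f) (LinearMap.range_le_ker_iff.mpr h)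
  have h2 : qdim (LinearMap.ker f.dualMap) (LinearMap.range g.dualMap) +
      finrank K (LinearMap.range g.dualMap) = finrank K (LinearMap.ker f.dualMap) := by
    have hle : LinearMap.range g.dualMap ≤ LinearMap.ker f.dualMap := by
      rintro _ ⟨y, rfl⟩
      rw [LinearMap.mem_ker]
      ext x
      have := LinearMap.congr_fun h x
      simp only [LinearMap.comp_apply, LinearMap.zero_apply] at this
      simp [LinearMap.dualMap_apply, this]
    exact qdim_add (V := Dual K P1) _ _ hle
  have h3 := LinearMap.finrank_range_add_finrank_ker g
  have h4 := LinearMap.finrank_range_add_finrank_ker f.dualMap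
  rw [LinearMap.finrank_range_dualMap_eq_finrank_range] at h2 h4
  rw [Subspace.dual_finrank_eq] at h4
  omega

namespace GC

variable (C : GC K n)

/-- the pairing with values in `K` -/
def pr (s : Idx) : (Fin (C.rk s) → Lau K n) →ₗ[K] (Fin (C.rk s) → PolyS K n) →ₗ[K] K :=
  LinearMap.mk₂ K (fun w v => (∑ p, toL (v p) * w p).coeff (fun _ => -1))
    (fun w w' v => by
      simp only [Pi.add_apply, mul_add, Finset.sum_add_distrib, AddMonoidAlgebra.coeff_add,
        Finsupp.add_apply])
    (fun c w v => by
      simp only [Pi.smul_apply, mul_smul_comm, ← Finset.smul_sum, AddMonoidAlgebra.coeff_smul,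
        Finsupp.smul_apply])
    (fun w v v' => by
      simp only [Pi.add_apply, map_add, add_mul, Finset.sum_add_distrib,
        AddMonoidAlgebra.coeff_add, Finsupp.add_apply])
    (fun c w v => by
      simp only [Pi.smul_apply, map_smul, smul_mul_assoc, ← Finset.smul_sum,
        AddMonoidAlgebra.coeff_smul, Finsupp.smul_apply])

lemma pr_apply (s : Idx) (w) (v) :
    C.pr s w v = (∑ p, toL (v p) * w p).coeff (fun _ => -1) := rfl

lemma pr_bd (s : Idx) (w : Fin (C.rk (nx s)) → Lau K n) (v : Fin (C.rk s) → PolyS K n) :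
    C.pr s (C.bd s w) v = C.pr (nx s) w ((C.dd s).transpose.mulVec v) := by
  rw [pr_apply, pr_apply]
  congr 2
  simp only [bd, Matrix.mulVecLin_apply, Matrix.mulVec, dotProduct, map_sum, map_mul,
    Matrix.map_apply, Matrix.transpose_apply, Finset.mul_sum, Finset.sum_mul]
  rw [Finset.sum_comm]
  refine Finset.sum_congr rfl fun q _ => Finset.sum_congr rfl fun p _ => ?_
  ring

/-- degree pieces of the dual complex -/
abbrev PD (s : Idx) (d : ℤ) : Submodule K (Fin (C.rk s) → PolyS K n) :=
  freePiece (fun p => -C.deg s p) d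

/-- the dual differential -/
def dl (s : Idx) (d : ℤ) : C.PD s d →ₗ[K] C.PD (nx s) d :=
  LinearMap.restrict ((C.dd s).transpose.mulVecLin.restrictScalars K) (by
    intro v hv
    rw [mem_freePiece] at *
    intro q
    simp only [LinearMap.restrictScalars_apply, Matrix.mulVecLin_apply, Matrix.mulVec, dotProduct,
      Matrix.transpose_apply]
    refine Submodule.sum_mem _ fun p _ => ?_
    rw [← toL_mem, map_mul]
    refine SP_mul ?_ (toL_mem.mpr (C.isHomog s p q)) (toL_mem.mpr (hv p))
    rintro a ⟨ha, ha'⟩ b ⟨hb, hb'⟩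
    refine ⟨fun i => add_nonneg (ha i) (hb i), ?_⟩
    simp only [Pi.add_apply, Finset.sum_add_distrib, ha', hb']
    ring)

lemma dl_apply (s : Idx) (d : ℤ) (v : C.PD s d) :
    (C.dl s d v : Fin (C.rk (nx s)) → PolyS K n) = (C.dd s).transpose.mulVec v.1 := rfl

lemma dl_dl (s : Idx) (d : ℤ) : (C.dl (nx s) d).comp (C.dl s d) = 0 := by
  ext v : 1
  apply Subtype.ext
  simp only [LinearMap.comp_apply, dl_apply, Matrix.mulVec_mulVec, ← Matrix.transpose_mul,
    C.isComplex, Matrix.transpose_zero, Matrix.zero_mulVec, LinearMap.zero_apply,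
    Submodule.coe_zero]

/-- the duality map -/
def Ph (s : Idx) (d : ℤ) : (Fin (C.rk s) → Lau K n) →ₗ[K] Dual K (C.PD s d) :=
  (LinearMap.lcomp K K (C.PD s d).subtype).comp (C.pr s)

lemma Ph_apply (s : Idx) (d : ℤ) (w) (v : C.PD s d) : C.Ph s d w v = C.pr s w v.1 := rfl

lemma Ph_bd (s : Idx) (d : ℤ) (w) :
    C.Ph s d (C.bd s w) = (C.dl s d).dualMap (C.Ph (nx s) d w) := by
  ext v
  rw [Ph_apply, pr_bd, LinearMap.dualMap_apply, Ph_apply, dl_apply]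

lemma pr_single (s : Idx) (w) (p : Fin (C.rk s)) (b : Fin n →₀ ℕ) :
    C.pr s w (Pi.single p (monomial b 1)) = (w p).coeff (fun i => -1 - b i) := by
  classical
  rw [pr_apply, Finset.sum_eq_single p]
  · rw [Pi.single_eq_same]
    have h1 : toL (monomial b (1 : K)) = mon K (expZ n b) := by
      rw [toL_apply, mon]
      exact AddMonoidAlgebra.mapDomain_single
    rw [h1, mon, AddMonoidAlgebra.coeff_single_mul_apply, one_mul]
    congr 1
    funext i
    simp [expZ_apply]
    ring
  · intro q _ hq
    rw [Pi.single_eq_of_ne hq, map_zero, zero_mul]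
  · intro h
    exact absurd (Finset.mem_univ _) h

lemma single_mem (s : Idx) {d : ℤ} (p : Fin (C.rk s)) (b : Fin n →₀ ℕ)
    (hb : ∑ i, (b i : ℤ) = d + C.deg s p) :
    (Pi.single p (monomial b 1) : Fin (C.rk s) → PolyS K n) ∈ C.PD s d := by
  classical
  rw [mem_freePiece]
  intro q
  by_cases hq : q = p
  · subst hq
    rw [Pi.single_eq_same, mem_homogZ]
    intro c hc
    rw [coeff_monomial] at hc
    split_ifs at hc with h
    · subst h
      simp only [expZ_apply, hb]
      ring
    · exact absurd rfl hc
  · rw [Pi.single_eq_of_ne hq]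
    exact Submodule.zero_mem _

lemma Ph_Vk {s : Idx} {d e : ℤ} {w} (hw : w ∈ C.X (Vk n n) s e) : C.Ph s d w = 0 := by
  ext v
  rw [Ph_apply, pr_apply, LinearMap.zero_apply]
  have h : (∑ p, toL (v.1 p) * w p) ∈ SP K (Vk n n) := by
    refine Submodule.sum_mem _ fun p _ => ?_
    refine SP_mul ?_ (toL_mem_Pos (v.1 p)) (SP_mono (fun _ h => h.1) (hw p trivial))
    intro a ha b hb
    rw [add_comm]
    exact up_Vk n b hb a ha
  by_contra h'
  obtain ⟨_, i, _, hi⟩ := mem_SP.mp h _ h'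
  simp at hi

lemma Ph_ker {s : Idx} {d e : ℤ} (hd : d = -e - n) {R : Set (Fin n → ℤ)} {w}
    (hw : w ∈ C.X R s e) (h : C.Ph s d w = 0) : w ∈ C.X (Vk n n) s e := by
  rw [mem_X] at *
  intro p a ha
  refine ⟨?_, (hw p a ha).2⟩
  by_contra hV
  have hneg : ∀ i, a i < 0 := by
    intro i
    by_contra hi
    exact hV ⟨fun j hj => absurd j.2 (by omega), i, i.2, by omega⟩
  let b : Fin n →₀ ℕ := Finsupp.equivFunOnFinite.symm fun i => (-1 - a i).toNat
  have hb : ∀ i, (b i : ℤ) = -1 - a i := by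
    intro i
    have := hneg i
    simp only [b, Finsupp.equivFunOnFinite_symm_apply_apply]
    omega
  have h1 : (Pi.single p (monomial b 1) : Fin (C.rk s) → PolyS K n) ∈ C.PD s d := by
    apply single_mem
    simp only [hb, Finset.sum_sub_distrib, (hw p a ha).2, hd]
    simp
    ring
  have h2 := LinearMap.congr_fun h ⟨_, h1⟩
  rw [Ph_apply, pr_single, LinearMap.zero_apply] at h2
  apply ha
  rw [← h2]
  congr 1
  funext i
  rw [hb]
  ring

lemma Ph_surj {s : Idx} {d e : ℤ} (hd : d = -e - n) (y : Dual K (C.PD s d)) :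
    ∃ w ∈ C.X Set.univ s e, C.Ph s d w = y := by
  classical
  have h1 : (((C.X Set.univ s e).map (C.Ph s d) : Submodule K (Dual K (C.PD s d)))).dualCoannihilator
      = ⊥ := by
    rw [eq_bot_iff]
    intro v hv
    rw [Submodule.mem_bot]
    by_contra hne
    have : ∃ p b, (v.1 p).coeff b ≠ 0 := by
      by_contra hall
      push Not at hall
      apply hne
      apply Subtype.ext
      funext p
      ext b
      simpa using hall p b
    obtain ⟨p, b, hb⟩ := this
    have hdeg := mem_homogZ.mp (v.2 p trivial) b hb
    have hw : (Pi.single p (mon K (fun i => -1 - (b i : ℤ))) : Fin (C.rk s) → Lau K n) ∈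
        C.X Set.univ s e := by
      rw [X, Submodule.mem_pi]
      intro q _
      by_cases hq : q = p
      · subst hq
        rw [Pi.single_eq_same]
        refine SP_mono ?_ (mon_mem _)
        rintro _ rfl
        refine ⟨trivial, ?_⟩
        simp only [expZ_apply] at hdeg
        rw [Finset.sum_sub_distrib, hdeg, hd]
        simp
        ring
      · rw [Pi.single_eq_of_ne hq]
        exact Submodule.zero_mem _
    rw [Submodule.mem_dualCoannihilator] at hv
    have h2 := hv _ (Submodule.mem_map_of_mem hw)
    rw [Ph_apply, pr_apply, Finset.sum_eq_single p] at h2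
    · rw [Pi.single_eq_same, mul_comm, mon, AddMonoidAlgebra.coeff_single_mul_apply, one_mul] at h2
      apply hb
      rw [← h2, ← coeff_toL]
      congr 1
      funext i
      simp [expZ_apply]
    · intro q _ hq
      rw [Pi.single_eq_of_ne hq, mul_zero]
    · intro h
      exact absurd (Finset.mem_univ _) h
  have h2 := Subspace.dualCoannihilator_dualAnnihilator_eq
    (W := (((C.X Set.univ s e).map (C.Ph s d) : Submodule K (Dual K (C.PD s d)))))
  rw [h1, Submodule.dualAnnihilator_bot] at h2
  have h3 : y ∈ (C.X Set.univ s e).map (C.Ph s d) := by rw [← h2]; trivial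
  exact h3

/-- cycles of the dual complex at position `nx s` -/
def ZD (s : Idx) (d : ℤ) : Submodule K (Fin (C.rk (nx s)) → PolyS K n) :=
  (LinearMap.ker (C.dd (nx s)).transpose.mulVecLin).restrictScalars K ⊓ C.PD (nx s) d

/-- boundaries of the dual complex at position `nx s` -/
def BD (s : Idx) : Submodule K (Fin (C.rk (nx s)) → PolyS K n) :=
  (LinearMap.range (C.dd s).transpose.mulVecLin).restrictScalars K

/-- dimension of the homology of the dual complex -/
def hD (s : Idx) (d : ℤ) : ℕ := qdim (C.ZD s d) (C.BD s)

lemma hD_eq (s : Idx) (d : ℤ) :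
    qdim (LinearMap.ker (C.dl (nx s) d)) (LinearMap.range (C.dl s d)) = C.hD s d := by
  refine qdim_eq _ _ _ _ (C.PD (nx s) d).subtype ?_ ?_ ?_
  · intro v hv
    refine ⟨?_, v.2⟩
    have := congrArg Subtype.val (LinearMap.mem_ker.mp hv)
    rwa [dl_apply] at this
  · intro v hv
    constructor
    · rintro ⟨u, rfl⟩
      exact ⟨u.1, rfl⟩
    · rintro ⟨u, hu⟩
      obtain ⟨u', h1, h2⟩ := exists_homog_comp (K := K) (fun p => -C.deg (nx s) p)
        (fun p => -C.deg s p) (C.dd s).transpose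
        (fun p q => by rw [neg_sub_neg]; exact C.isHomog s q p) v.2 u hu
      exact ⟨⟨u', h1⟩, Subtype.ext h2⟩
  · intro y hy
    refine ⟨⟨y, hy.2⟩, ?_, ?_⟩
    · rw [LinearMap.mem_ker]
      exact Subtype.ext hy.1
    · simp

lemma hU_eq_hD (s : Idx) {d e : ℤ} (hd : d = -e - n) :
    C.hU Set.univ (Vk n n) s e = C.hD s d := by
  rw [← hD_eq, qdim_dual _ _ (C.dl_dl s d)]
  refine qdim_eq _ _ _ _ (C.Ph (nx s) d) ?_ ?_ ?_
  · intro z hz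
    rw [LinearMap.mem_ker, ← Ph_bd]
    exact C.Ph_Vk hz.2
  · intro z hz
    constructor
    · intro h
      obtain ⟨b, hb, v, hv, rfl⟩ := C.mem_B.mp h
      rw [map_add, Ph_bd, C.Ph_Vk hv, add_zero]
      exact ⟨_, rfl⟩
    · rintro ⟨y, hy⟩
      obtain ⟨b, hb, rfl⟩ := C.Ph_surj hd y
      rw [← Ph_bd] at hy
      rw [mem_B]
      have hb' : C.bd (nx s) b ∈ C.X Set.univ (nx s) e :=
        C.bd_mem (U := Set.univ) (fun _ _ _ _ => trivial) hb
      refine ⟨b, hb, z - C.bd (nx s) b, C.Ph_ker hd (Submodule.sub_mem _ hz.1 hb') ?_, by abel⟩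
      rw [map_sub, hy, sub_self]
  · intro y hy
    obtain ⟨z, hz, rfl⟩ := C.Ph_surj hd y
    refine ⟨z, ⟨hz, ?_⟩, ?_⟩
    · rw [LinearMap.mem_ker, ← Ph_bd] at hy
      exact C.Ph_ker hd (C.bd_mem (U := Set.univ) (fun _ _ _ _ => trivial) hz) hy
    · rw [sub_self]; exact Submodule.zero_mem _

/-- polynomial torsion -/
def TorS (j : Fin n) : Prop :=
  ∀ s e v, v ∈ C.ZS s e → ∃ t : ℕ, (MvPolynomial.X j : PolyS K n) ^ t • v ∈ C.BS s

lemma Tor_of_TorS {j : Fin n} (h : C.TorS j) : C.Tor (Pos n) ∅ j := by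
  intro s e z hz
  obtain ⟨v, hv, rfl⟩ := C.exists_toLv hz.1
  obtain ⟨t, ht⟩ := h s e v (C.toLv_ZS.mp hz)
  refine ⟨t, ?_⟩
  have h1 : mon K (Pi.single j (t : ℤ)) • toLv _ v = toLv _ ((MvPolynomial.X j : PolyS K n) ^ t • v) := by
    funext p
    rw [Pi.smul_apply, toLv_apply, toLv_apply, Pi.smul_apply, smul_eq_mul, smul_eq_mul, map_mul]
    congr 1
    rw [X_pow_eq_monomial, toL_apply, mon]
    refine Eq.trans ?_ AddMonoidAlgebra.mapDomain_single.symm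
    congr 1
    funext i
    rw [expZ_apply]
    by_cases hi : i = j
    · subst hi; simp
    · simp [hi]
  rw [h1, toLv_BS]
  · exact ht
  · rw [← toLv_mem, ← h1]
    refine C.mon_mem_X _ ?_ (by simp) hz.1
    intro a ha i
    by_cases hi : i = j
    · subst hi; simpa using add_nonneg (Int.natCast_nonneg t) (ha i)
    · simpa [hi] using ha i

/-- Graded local duality for complexes with torsion homology. -/
theorem local_duality (h : ∀ j, C.TorS j) (s : Idx) {d e : ℤ} (hd : d = -e - n) :
    C.hD (nx^[n] s) d = C.hS s e := by
  have h1 := (C.hU_iter (fun j => C.Tor_of_TorS (h j)) n le_rfl).2 s e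
  have h2 : Uk n n = Set.univ := by
    ext a
    simp only [Uk, Set.mem_univ, iff_true]
    intro i hi
    exact absurd i.2 (by omega)
  rw [h2, C.hU_eq_hD _ hd, hU_eq_hS] at h1
  exact h1

end GC

/-! ### Moving to the right -/

lemma qdim_eq_zero {X : Type*} [AddCommGroup X] [Module K X] (Z B : Submodule K X)
    [FiniteDimensional K Z] : qdim Z B = 0 ↔ Z ≤ B := by
  rw [qdim, Module.finrank_zero_iff, Submodule.Quotient.subsingleton_iff]
  constructor
  · intro h z hz
    have : (⟨z, hz⟩ : Z) ∈ Submodule.comap Z.subtype B := by rw [h]; trivial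
    exact this
  · intro h
    rw [eq_top_iff]
    rintro ⟨z, hz⟩ _
    exact h hz

lemma qdim_eq_zero_of_le {X : Type*} [AddCommGroup X] [Module K X] (Z B : Submodule K X)
    (h : Z ≤ B) : qdim Z B = 0 := by
  have : Submodule.comap Z.subtype B = ⊤ := by
    rw [eq_top_iff]
    rintro ⟨z, hz⟩ _
    exact h hz
  rw [qdim, this]
  exact Module.finrank_zero_of_subsingleton

/-- monomials in the ideal of the first `p` variables -/
def Wp (n p : ℕ) : Set (Fin n → ℤ) := {a | a ∈ Pos n ∧ ∃ i : Fin n, i.val < p ∧ 1 ≤ a i}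

lemma up_Pos : Up (Pos n) := fun _ ha _ hb i => add_nonneg (ha i) (hb i)

lemma up_Wp (p : ℕ) : Up (Wp n p) := by
  rintro a ⟨ha, i, hi, hi'⟩ b hb
  refine ⟨up_Pos a ha b hb, i, hi, ?_⟩
  have := hb i
  simp only [Pi.add_apply]
  omega

lemma Wp_zero : Wp n 0 = ∅ := by
  ext a
  simp [Wp]

lemma Wp_sub (p : ℕ) : Wp n p ⊆ Wp n (p + 1) := fun _ ⟨h, i, hi, hi'⟩ => ⟨h, i, by omega, hi'⟩

lemma single_pos (p : Fin n) : (Pi.single p 1 : Fin n → ℤ) ∈ Pos n := by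
  intro i
  by_cases h : i = p
  · subst h; simp
  · simp [h]

namespace GC

variable (C : GC K n)

/-- multiplication by a variable -/
abbrev xm (K : Type) [Field K] {n : ℕ} (p : Fin n) : Lau K n := mon K (Pi.single p 1)

lemma xm_mem {U : Set (Fin n → ℤ)} (hU : Up U) (p : Fin n) {s : Idx} {e : ℤ} {w}
    (hw : w ∈ C.X U s e) : xm K p • w ∈ C.X U s (e + 1) := by
  refine C.mon_mem_X _ ?_ (by simp) hw
  intro a ha
  rw [add_comm (Pi.single p 1) a]
  exact hU a ha _ (single_pos p)

lemma xm_mem_W (p : Fin n) {s : Idx} {e : ℤ} {w}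
    (hw : w ∈ C.X (Pos n) s e) : xm K p • w ∈ C.X (Wp n (p + 1)) s (e + 1) := by
  refine C.mon_mem_X _ ?_ (by simp) hw
  intro a ha
  rw [add_comm (Pi.single p 1) a]
  refine ⟨up_Pos a ha _ (single_pos p), p, by omega, ?_⟩
  have := ha p
  simp
  omega

lemma xm_cancel (p : Fin n) {s : Idx} {e : ℤ} {w} (hw : w ∈ C.X (Pos n) s e)
    (h : xm K p • w ∈ C.X (Wp n p) s (e + 1)) : w ∈ C.X (Wp n p) s e := by
  have h1 : w ∈ C.X {a | Pi.single p 1 + a ∈ Wp n p} s e := by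
    have := C.mon_mem_X (R' := {a | Pi.single p 1 + a ∈ Wp n p}) (-Pi.single p 1)
      (fun a ha => by simpa using ha) (e' := e) (by simp) h
    rwa [mon_neg_mon] at this
  refine C.X_inter hw h1 ?_
  rintro a ⟨ha, _, i, hi, hi'⟩
  refine ⟨ha, i, hi, ?_⟩
  have : i ≠ p := fun h => by subst h; omega
  simpa [this] using hi'

lemma xm_split (p : Fin n) {s : Idx} {e : ℤ} {w} (hw : w ∈ C.X (Wp n (p + 1)) s (e + 1)) :
    ∃ u ∈ C.X (Pos n) s e, ∃ v ∈ C.X (Wp n p) s (e + 1), w = xm K p • u + v := by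
  have h : Wp n (p + 1) ⊆ {a | a ∈ Pos n ∧ 1 ≤ a p} ∪ Wp n p := by
    rintro a ⟨ha, i, hi, hi'⟩
    rcases Nat.lt_or_ge i.val p.val with h | h
    · exact Or.inr ⟨ha, i, h, hi'⟩
    · have : i = p := Fin.ext (by omega)
      subst this
      exact Or.inl ⟨ha, hi'⟩
  obtain ⟨u, hu, v, hv, rfl⟩ := C.X_split h hw
  refine ⟨mon K (-Pi.single p 1) • u, C.mon_mem_X _ ?_ (by simp) hu, v, hv, ?_⟩
  · rintro a ⟨ha, ha'⟩ i
    by_cases h : i = p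
    · subst h; simpa using ha'
    · simpa [h] using ha i
  · rw [mon_mon, add_neg_cancel, mon_zero, one_smul]

/-- vanishing of relative homology -/
def Van (p : ℕ) (s : Idx) (e : ℤ) : Prop :=
  ∀ z, z ∈ C.Z (Pos n) (Wp n p) s e → z ∈ C.B (Pos n) (Wp n p) s e

lemma Wp_sub_Pos (p : ℕ) : Wp n p ⊆ Pos n := fun _ h => h.1

lemma van_A (p : Fin n) (s : Idx) (e : ℤ) (h1 : C.Van p s e) (h2 : C.Van p (nx s) (e + 1)) :
    C.Van (p + 1) (nx s) (e + 1) := by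
  intro z hz
  obtain ⟨u, hu, v, hv, huv⟩ := C.xm_split p hz.2
  replace huv : C.bd (nx s) z = xm K p • u + v := huv
  have hu' : u ∈ C.Z (Pos n) (Wp n p) s e := by
    refine ⟨hu, C.xm_cancel p (C.bd_mem up_Pos hu) ?_⟩
    have h3 := C.bd_bd s z
    rw [huv, map_add, map_smul] at h3
    rw [bdK_apply, eq_neg_of_add_eq_zero_left h3]
    exact Submodule.neg_mem _ (C.bd_mem (up_Wp p) hv)
  obtain ⟨b, hb, v', hv', rfl⟩ := C.mem_B.mp (h1 u hu')
  have h4 : z - xm K p • b ∈ C.Z (Pos n) (Wp n p) (nx s) (e + 1) := by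
    rw [mem_Z]
    refine ⟨Submodule.sub_mem _ hz.1 (C.xm_mem up_Pos p hb), ?_⟩
    rw [map_sub, huv, map_smul, smul_add, add_assoc, add_sub_cancel_left]
    exact Submodule.add_mem _ (C.xm_mem (up_Wp p) p hv') hv
  obtain ⟨b', hb', w, hw, h5⟩ := C.mem_B.mp (h2 _ h4)
  rw [mem_B]
  refine ⟨b', hb', xm K p • b + w, Submodule.add_mem _ (C.xm_mem_W p hb)
    (C.X_mono (Wp_sub p) _ _ hw), ?_⟩
  rw [sub_eq_iff_eq_add] at h5
  rw [h5]
  abel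

lemma van_B (p : Fin n) (s : Idx) (d : ℤ) (h1 : C.Van p s (d + 1))
    (h2 : C.Van (p + 1) (nx s) (d + 1)) : C.Van p s d := by
  intro z hz
  have hxz : xm K p • z ∈ C.Z (Pos n) (Wp n p) s (d + 1) := by
    rw [mem_Z, map_smul]
    exact ⟨C.xm_mem up_Pos p hz.1, C.xm_mem (up_Wp p) p hz.2⟩
  obtain ⟨b, hb, v, hv, h3⟩ := C.mem_B.mp (h1 _ hxz)
  have hb' : b ∈ C.Z (Pos n) (Wp n (p + 1)) (nx s) (d + 1) := by
    rw [mem_Z]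
    refine ⟨hb, ?_⟩
    have : C.bd (nx s) b = xm K p • z - v := by rw [h3]; abel
    rw [this]
    exact Submodule.sub_mem _ (C.xm_mem_W p hz.1) (C.X_mono (Wp_sub p) _ _ hv)
  obtain ⟨b2, hb2, w, hw, rfl⟩ := C.mem_B.mp (h2 _ hb')
  obtain ⟨u, hu, v2, hv2, rfl⟩ := C.xm_split p hw
  rw [map_add, map_add, bd_bd, zero_add, map_smul] at h3
  have h4 : z - C.bd (nx s) u ∈ C.X (Wp n p) (nx s) d := by
    refine C.xm_cancel p (Submodule.sub_mem _ hz.1 (C.bd_mem up_Pos hu)) ?_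
    rw [smul_sub, h3, add_assoc, add_sub_cancel_left]
    exact Submodule.add_mem _ (C.bd_mem (up_Wp p) hv2) hv
  rw [mem_B]
  exact ⟨u, hu, _, h4, by abel⟩

lemma van_zero (p : Fin n) (s : Idx) (hs : C.rk (nx (nx s)) = 0) (d : ℤ)
    (h1 : C.Van p s (d + 1)) : C.Van p s d := by
  intro z hz
  have hxz : xm K p • z ∈ C.Z (Pos n) (Wp n p) s (d + 1) := by
    rw [mem_Z, map_smul]
    exact ⟨C.xm_mem up_Pos p hz.1, C.xm_mem (up_Wp p) p hz.2⟩
  obtain ⟨b, hb, v, hv, h3⟩ := C.mem_B.mp (h1 _ hxz)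
  have : b = 0 := by
    funext q
    exact absurd q.2 (by omega)
  rw [this, map_zero, zero_add] at h3
  rw [mem_B]
  refine ⟨0, Submodule.zero_mem _, z, ?_, by rw [map_zero, zero_add]⟩
  refine C.xm_cancel p hz.1 ?_
  rw [h3]
  exact hv

lemma van_main (h0 : C.rk (.inr 0) = 0) (j : ℕ) : ∀ (p : ℕ) (d : ℤ), p + j < n →
    (∀ k l : ℕ, k + l = j → C.Van p (.inl (k + 1)) (d + 1 + l)) → C.Van p (.inl (j + 1)) d := by
  induction j with
  | zero =>
    intro p d hp h
    refine C.van_zero ⟨p, by omega⟩ (.inl 1) h0 d ?_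
    simpa using h 0 0 rfl
  | succ j ih =>
    intro p d hp h
    refine C.van_B ⟨p, by omega⟩ (.inl (j + 2)) d ?_ ?_
    · simpa using h (j + 1) 0 rfl
    · refine ih (p + 1) (d + 1) (by omega) ?_
      intro k l hkl
      have h1 := h (k + 1) l (by omega)
      have h2 := h k (l + 1) (by omega)
      have h3 := C.van_A ⟨p, by omega⟩ (.inl (k + 2)) (d + 1 + l) h1
        (by push_cast at h2; rw [← add_assoc] at h2; exact h2)
      have e1 : d + 1 + 1 + l = d + 1 + l + 1 := by ring
      rw [e1]
      exact h3

instance ZS_finite (s : Idx) (e : ℤ) : FiniteDimensional K (C.ZS s e) :=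
  Submodule.finiteDimensional_of_le (S₂ := freePiece (C.deg (nx s)) e) inf_le_right

lemma van_iff (s : Idx) (e : ℤ) : C.Van 0 s e ↔ C.hS s e = 0 := by
  rw [hS, qdim_eq_zero, Van, Wp_zero]
  constructor
  · intro h v hv
    exact (C.toLv_BS hv.2).mp (h _ (C.toLv_ZS.mpr hv))
  · intro h z hz
    obtain ⟨v, hv, rfl⟩ := C.exists_toLv hz.1
    exact (C.toLv_BS hv).mpr (h (C.toLv_ZS.mp hz))

theorem right_move (h0 : C.rk (.inr 0) = 0) (j : ℕ) (hj : j < n) (d : ℤ)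
    (h : C.hS (.inl (j + 1)) d ≠ 0) :
    ∃ k l : ℕ, k + l = j ∧ C.hS (.inl (k + 1)) (d + 1 + l) ≠ 0 := by
  by_contra hcon
  push Not at hcon
  apply h
  rw [← van_iff]
  refine C.van_main h0 j 0 d (by omega) ?_
  intro k l hkl
  rw [van_iff]
  exact hcon k l hkl

end GC

/-! ### Fitting ideals and homotopies -/

/-- The ideal of elements `c` such that `A h A = c A` for some `h`. -/
def regIdeal {R : Type*} [CommRing R] {a b : ℕ} (A : Matrix (Fin a) (Fin b) R) : Ideal R where
  carrier := {c | ∃ h : Matrix (Fin b) (Fin a) R, A * h * A = c • A}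
  add_mem' := by
    rintro c c' ⟨h, hh⟩ ⟨h', hh'⟩
    exact ⟨h + h', by rw [Matrix.mul_add, Matrix.add_mul, hh, hh', add_smul]⟩
  zero_mem' := ⟨0, by simp⟩
  smul_mem' := by
    rintro c c' ⟨h, hh⟩
    exact ⟨c • h, by rw [Matrix.mul_smul, Matrix.smul_mul, hh, smul_smul, smul_eq_mul]⟩

lemma bordered {R : Type*} [CommRing R] [IsDomain R] {s : ℕ} (B : Matrix (Fin s) (Fin s) R)
    (c : Matrix (Fin s) Unit R) (r : Matrix Unit (Fin s) R) (d : Matrix Unit Unit R)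
    (hB : B.det ≠ 0) (h : (Matrix.fromBlocks B c r d).det = 0) :
    B.det • d = r * B.adjugate * c := by
  have h1 : Matrix.fromBlocks B c r d *
      Matrix.fromBlocks 1 (-(B.adjugate * c)) 0 (B.det • (1 : Matrix Unit Unit R)) =
      Matrix.fromBlocks B 0 r (B.det • d - r * B.adjugate * c) := by
    rw [Matrix.fromBlocks_multiply]
    congr 1
    · simp
    · rw [Matrix.mul_neg, ← Matrix.mul_assoc, Matrix.mul_adjugate]
      simp
    · simp
    · rw [Matrix.mul_neg, ← Matrix.mul_assoc, Matrix.mul_smul, Matrix.mul_one]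
      abel
  have h2 := congrArg Matrix.det h1
  rw [Matrix.det_mul, h, zero_mul, Matrix.det_fromBlocks_zero₁₂] at h2
  have h3 := (mul_eq_zero.mp h2.symm).resolve_left hB
  rw [Matrix.det_unique] at h3
  ext i j
  have := sub_eq_zero.mp h3
  exact this

lemma minors_le_reg {a b : ℕ} (A : Matrix (Fin a) (Fin b) (PolyS K n)) (s : ℕ)
    (h : minorsIdeal A (s + 1) = ⊥) : minorsIdeal A s ≤ regIdeal A := by
  rw [minorsIdeal, Ideal.span_le]
  rintro _ ⟨⟨f, g⟩, rfl⟩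
  simp only
  by_cases hδ : (A.submatrix f g).det = 0
  · rw [hδ]
    exact Submodule.zero_mem _
  classical
  refine ⟨(1 : Matrix (Fin b) (Fin b) (PolyS K n)).submatrix id g * (A.submatrix f g).adjugate *
    (1 : Matrix (Fin a) (Fin a) (PolyS K n)).submatrix f id, ?_⟩
  have e1 : A * ((1 : Matrix (Fin b) (Fin b) (PolyS K n)).submatrix id g *
      (A.submatrix f g).adjugate *
      (1 : Matrix (Fin a) (Fin a) (PolyS K n)).submatrix f id) * A =
      A.submatrix id g * (A.submatrix f g).adjugate * A.submatrix f id := by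
    have e2 : A * (1 : Matrix (Fin b) (Fin b) (PolyS K n)).submatrix id g = A.submatrix id g := by
      ext i j
      simp [Matrix.mul_apply, Matrix.one_apply]
    have e3 : (1 : Matrix (Fin a) (Fin a) (PolyS K n)).submatrix f id * A = A.submatrix f id := by
      ext i j
      simp [Matrix.mul_apply, Matrix.one_apply]
    rw [Matrix.mul_assoc, Matrix.mul_assoc _ _ A, e3, ← Matrix.mul_assoc, ← Matrix.mul_assoc, e2]
  rw [e1]
  ext1 p q
  have hdet : (A.submatrix (Sum.elim f (fun _ : Unit => p)) (Sum.elim g (fun _ : Unit => q))).det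
      = 0 := by
    by_cases hi : Function.Injective (Sum.elim f (fun _ : Unit => p))
    · by_cases hj : Function.Injective (Sum.elim g (fun _ : Unit => q))
      · let eq : Fin (s + 1) ≃ Fin s ⊕ Unit :=
          finSumFinEquiv.symm.trans (Equiv.sumCongr (Equiv.refl _) finOneEquiv)
        have hm : (A.submatrix ((eq.toEmbedding.trans ⟨_, hi⟩ : Fin (s + 1) ↪ Fin a))
            ((eq.toEmbedding.trans ⟨_, hj⟩ : Fin (s + 1) ↪ Fin b))).det ∈ minorsIdeal A (s + 1) :=
          Ideal.subset_span ⟨(_, _), rfl⟩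
        rw [h, Ideal.mem_bot] at hm
        rw [← hm, ← Matrix.det_submatrix_equiv_self eq]
        rfl
      · rw [Function.Injective] at hj
        push Not at hj
        obtain ⟨i, j, h1, h2⟩ := hj
        exact Matrix.det_zero_of_column_eq h2 fun k => by simp only [Matrix.submatrix_apply, h1]
    · rw [Function.Injective] at hi
      push Not at hi
      obtain ⟨i, j, h1, h2⟩ := hi
      refine Matrix.det_zero_of_row_eq h2 ?_
      funext k
      simp only [Matrix.submatrix_apply, h1]
  have hb := bordered (A.submatrix f g) (A.submatrix f (fun _ : Unit => q))
    (A.submatrix (fun _ : Unit => p) g) (A.submatrix (fun _ : Unit => p) (fun _ : Unit => q)) hδ (by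
      rw [← hdet]
      congr 1
      ext i j
      rcases i with i | i <;> rcases j with j | j <;> rfl)
  have := congrFun (congrFun hb ()) ()
  simp only [Matrix.smul_apply, Matrix.submatrix_apply, smul_eq_mul] at this ⊢
  rw [this]
  rfl

lemma exists_reg (F : FreeComplex K n) (r : ℕ) (hvb : IsVectorBundle F r) :
    ∃ N : ℕ, (irrel K n) ^ N ≤ regIdeal (F.dd 0) := by
  obtain ⟨h0, N, hN⟩ := hvb
  refine ⟨N, hN.trans ?_⟩
  rw [fittingIdeal] at h0
  split_ifs at h0 with h1
  · exact absurd h0 top_ne_bot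
  · obtain ⟨s, hs⟩ : ∃ s : ℕ, (F.rk 0 : ℤ) - r = s := ⟨((F.rk 0 : ℤ) - r).toNat, by omega⟩
    have hs1 : ((F.rk 0 : ℤ) - (r - 1)).toNat = s + 1 := by omega
    rw [hs1] at h0
    refine le_trans ?_ (minors_le_reg _ s h0)
    rw [fittingIdeal, hs]
    split_ifs with h2
    · have : s = 0 := by omega
      subst this
      have h3 : (1 : PolyS K n) ∈ minorsIdeal (F.dd 0) 0 :=
        Ideal.subset_span ⟨(⟨Fin.elim0, fun i => i.elim0⟩, ⟨Fin.elim0, fun i => i.elim0⟩),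
          Matrix.det_fin_zero⟩
      rw [(Ideal.eq_top_iff_one _).mpr h3]
    · simp

lemma exists_right_factor {R : Type*} [CommRing R] {a b c : ℕ} (D : Matrix (Fin a) (Fin b) R)
    (M : Matrix (Fin a) (Fin c) R) (h : ∀ q, M.col q ∈ LinearMap.range D.mulVecLin) :
    ∃ H : Matrix (Fin b) (Fin c) R, D * H = M := by
  choose w hw using h
  refine ⟨Matrix.of fun i j => w j i, ?_⟩
  ext i j
  have := congrFun (hw j) i
  simpa [Matrix.mul_apply, Matrix.mulVec, dotProduct] using this

lemma homotopy (F : FreeComplex K n) (hres : IsResolution F) (c : PolyS K n) (l : ℕ) :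
    c ∈ regIdeal (F.dd 0) → c ∈ regIdeal (F.dd l) := by
  intro hc
  induction l with
  | zero => exact hc
  | succ l ih =>
    obtain ⟨h, hh⟩ := ih
    have h1 : F.dd l * (c • (1 : Matrix _ _ (PolyS K n)) - h * F.dd l) = 0 := by
      rw [Matrix.mul_sub, ← Matrix.mul_assoc, hh]
      simp
    obtain ⟨H, hH⟩ := exists_right_factor (F.dd (l + 1))
      (c • (1 : Matrix _ _ (PolyS K n)) - h * F.dd l) (by
        intro q
        rw [← hres l, LinearMap.mem_ker, Matrix.mulVecLin_apply]
        funext p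
        exact congrFun (congrFun h1 p) q)
    refine ⟨H, ?_⟩
    rw [hH, Matrix.sub_mul, Matrix.mul_assoc, F.isComplex]
    simp

lemma ext_torsion (F : FreeComplex K n) (hres : IsResolution F) (c : PolyS K n)
    (hc : c ∈ regIdeal (F.dd 0)) (l : ℕ) (v : Fin (F.rk (l + 1)) → PolyS K n)
    (hv : (F.dd (l + 1)).transpose.mulVec v = 0) :
    ∃ w, (F.dd l).transpose.mulVec w = c • v := by
  obtain ⟨h, hh⟩ := homotopy F hres c l hc
  have h1 : F.dd l * (c • (1 : Matrix _ _ (PolyS K n)) - h * F.dd l) = 0 := by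
    rw [Matrix.mul_sub, ← Matrix.mul_assoc, hh]
    simp
  obtain ⟨H, hH⟩ := exists_right_factor (F.dd (l + 1))
    (c • (1 : Matrix _ _ (PolyS K n)) - h * F.dd l) (by
      intro q
      rw [← hres l, LinearMap.mem_ker, Matrix.mulVecLin_apply]
      funext p
      exact congrFun (congrFun h1 p) q)
  refine ⟨h.transpose.mulVec v, ?_⟩
  have h2 : c • (1 : Matrix _ _ (PolyS K n)) = F.dd (l + 1) * H + h * F.dd l := by
    rw [hH]; abel
  have h3 := congrArg (fun M => M.transpose.mulVec v) h2
  simp only [Matrix.transpose_add, Matrix.transpose_mul, Matrix.add_mulVec,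
    ← Matrix.mulVec_mulVec, hv, Matrix.mulVec_zero, zero_add, Matrix.transpose_smul,
    Matrix.transpose_one, Matrix.smul_mulVec, Matrix.one_mulVec] at h3
  exact h3.symm

lemma X_pow_mem_reg (F : FreeComplex K n) (r : ℕ) (hvb : IsVectorBundle F r) :
    ∃ N : ℕ, ∀ j, (X j : PolyS K n) ^ N ∈ regIdeal (F.dd 0) := by
  obtain ⟨N, hN⟩ := exists_reg F r hvb
  exact ⟨N, fun j => hN (Ideal.pow_mem_pow (I := irrel K n) (Ideal.subset_span (Set.mem_range_self j)) N)⟩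

/-! ### Gluing -/

/-- ranks of the glued complex -/
def gRk (F F' : FreeComplex K n) : Idx → ℕ
  | .inl l => F.rk l
  | .inr k => F'.rk k

/-- degrees of the glued complex -/
def gDeg (F F' : FreeComplex K n) : (s : Idx) → Fin (gRk F F' s) → ℤ
  | .inl l => fun p => -F.deg l p
  | .inr k => fun p => F'.deg k p

/-- differential of the glued complex -/
def gDd (F F' : FreeComplex K n) (ε : Matrix (Fin (F.rk 0)) (Fin (F'.rk 0)) (PolyS K n)) :
    (s : Idx) → Matrix (Fin (gRk F F' s)) (Fin (gRk F F' (nx s))) (PolyS K n)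
  | .inl 0 => ε
  | .inl (l + 1) => (F.dd l).transpose
  | .inr k => F'.dd k

/-- the complex obtained by gluing a complex `F'` with the dual of `F` -/
def glue (F F' : FreeComplex K n) (ε : Matrix (Fin (F.rk 0)) (Fin (F'.rk 0)) (PolyS K n))
    (h1 : ∀ p q, ε p q ∈ homogZ K n (F'.deg 0 q + F.deg 0 p))
    (h2 : (F.dd 0).transpose * ε = 0) (h3 : ε * F'.dd 0 = 0) : GC K n where
  rk := gRk F F'
  deg := gDeg F F'
  dd := gDd F F' ε
  isHomog := by
    rintro ((_ | l) | k) p q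
    · have := h1 p q
      rw [← sub_neg_eq_add] at this
      exact this
    · have := F.isHomog l q p
      rw [← neg_sub_neg] at this
      exact this
    · exact F'.isHomog k p q
  isComplex := by
    rintro ((_ | _ | l) | k)
    · exact h3
    · exact h2
    · have : (F.dd (l + 1)).transpose * (F.dd l).transpose = 0 := by
        rw [← Matrix.transpose_mul, F.isComplex, Matrix.transpose_zero]
      exact this
    · exact F'.isComplex k

/-- the zero complex -/
def zeroFC (K : Type) [Field K] (n : ℕ) : FreeComplex K n where
  len := 0
  rk := fun _ => 0
  deg := fun _ _ => 0
  dd := fun _ => 0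
  rk_eq_zero := fun _ _ => rfl
  isHomog := fun _ p => p.elim0
  isComplex := fun _ => by simp

/-- the dual of `F` as a two-sided complex -/
def dualGC (F : FreeComplex K n) : GC K n :=
  glue F (zeroFC K n) (fun _ q => q.elim0) (fun _ q => q.elim0) (by ext _ q; exact q.elim0)
    (by ext _ q; exact q.elim0)

lemma dualGC_hS (F : FreeComplex K n) (j : ℕ) (e : ℤ) :
    (dualGC F).hS (.inl (j + 1)) e = cohomDim (dualCo F) j e := by
  rcases j with _ | j
  · have h : (dualGC F).BS (.inl 1) = (dualCo F).imSub 0 := by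
      have h' : (dualGC F).BS (.inl 1) = ⊥ := by
        rw [eq_bot_iff]
        rintro v ⟨w, rfl⟩
        rw [Submodule.mem_bot]
        have : w = 0 := funext fun q => Fin.elim0 q
        rw [this, map_zero]
      rw [h']
      rfl
    unfold GC.hS
    rw [h]
    rfl
  · rfl

theorem ext_right_move (F : FreeComplex K n) (j : ℕ) (hj : j < n) (d : ℤ)
    (h : cohomDim (dualCo F) j d ≠ 0) :
    ∃ k l : ℕ, k + l = j ∧ cohomDim (dualCo F) k (d + 1 + l) ≠ 0 := by
  rw [← dualGC_hS] at h
  obtain ⟨k, l, h1, h2⟩ := (dualGC F).right_move rfl j hj d h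
  exact ⟨k, l, h1, by rwa [dualGC_hS] at h2⟩

/-- The hypotheses on the dual module. -/
structure DualData (F F' : FreeComplex K n) where
  ε : Matrix (Fin (F.rk 0)) (Fin (F'.rk 0)) (PolyS K n)
  h1 : ∀ p q, ε p q ∈ homogZ K n (F'.deg 0 q + F.deg 0 p)
  h2 : (F.dd 0).transpose * ε = 0
  h3 : ε * F'.dd 0 = 0
  ex0 : ∀ v, (F.dd 0).transpose.mulVec v = 0 → ∃ w, ε.mulVec w = v
  ex1 : ∀ w, ε.mulVec w = 0 → ∃ u, (F'.dd 0).mulVec u = w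

lemma single_mem_freePiece {r : ℕ} (dg : Fin r → ℤ) (p : Fin r) :
    (Pi.single p 1 : Fin r → PolyS K n) ∈ freePiece dg (dg p) := by
  rw [mem_freePiece]
  intro q
  by_cases h : q = p
  · subst h
    rw [Pi.single_eq_same, mem_homogZ]
    intro b hb
    classical
    rw [coeff_one] at hb
    split_ifs at hb with h
    · subst h; simp
    · exact absurd rfl hb
  · rw [Pi.single_eq_of_ne h]
    exact Submodule.zero_mem _

/-- construction of the gluing data -/
def mkDualData (F F' : FreeComplex K n)
    (ψ : Mmod F' ≃ₗ[PolyS K n] (Mmod F →ₗ[PolyS K n] PolyS K n))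
    (hψ : ∀ e : ℤ, (MpieceIm F' e).map ((ψ.restrictScalars K).toLinearMap) = dualPiece F e) :
    DualData F F' := by
  let ε : Matrix (Fin (F.rk 0)) (Fin (F'.rk 0)) (PolyS K n) :=
    Matrix.of fun p q => ψ (Submodule.Quotient.mk (Pi.single q 1)) (Submodule.Quotient.mk (Pi.single p 1))
  have key : ∀ w p, ε.mulVec w p = ψ (Submodule.Quotient.mk w) (Submodule.Quotient.mk (Pi.single p 1)) := by
    intro w p
    have hw : w = ∑ q, w q • (Pi.single q 1 : Fin (F'.rk 0) → PolyS K n) := by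
      rw [← pi_eq_sum_univ' w]
    have h := congrArg (fun u => ψ ((LinearMap.range ((F'.dd 0).mulVecLin)).mkQ u)
      (Submodule.Quotient.mk (Pi.single p 1))) hw
    simp only [map_sum, map_smul, LinearMap.sum_apply, LinearMap.smul_apply, smul_eq_mul] at h
    simp only [Submodule.mkQ_apply] at h
    rw [h]
    simp only [Matrix.mulVec, dotProduct, ε, Matrix.of_apply]
    exact Finset.sum_congr rfl fun q _ => mul_comm _ _
  have key2 : ∀ w v, v ⬝ᵥ ε.mulVec w = ψ (Submodule.Quotient.mk w) (Submodule.Quotient.mk v) := by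
    intro w v
    have hv : v = ∑ q, v q • (Pi.single q 1 : Fin (F.rk 0) → PolyS K n) := by
      rw [← pi_eq_sum_univ' v]
    have h := congrArg (fun u => ψ (Submodule.Quotient.mk w)
      ((LinearMap.range ((F.dd 0).mulVecLin)).mkQ u)) hv
    simp only [map_sum, map_smul, smul_eq_mul] at h
    simp only [Submodule.mkQ_apply] at h
    rw [h]
    simp only [dotProduct, key]
  refine ⟨ε, ?_, ?_, ?_, ?_, ?_⟩
  · intro p q
    have h1 : ψ (Submodule.Quotient.mk (Pi.single q 1)) ∈ dualPiece F (F'.deg 0 q) := by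
      rw [← hψ]
      exact ⟨_, ⟨_, single_mem_freePiece _ q, rfl⟩, rfl⟩
    have h2 := h1 (F.deg 0 p) (Submodule.Quotient.mk (Pi.single p 1))
      ⟨_, single_mem_freePiece _ p, rfl⟩
    rw [add_comm] at h2
    exact h2
  · apply Matrix.ext_of_mulVec_single
    intro q
    rw [← Matrix.mulVec_mulVec, Matrix.zero_mulVec]
    funext c
    have h : ((F.dd 0).transpose.mulVec (ε.mulVec (Pi.single q 1))) c =
        ((F.dd 0).mulVec (Pi.single c 1)) ⬝ᵥ ε.mulVec (Pi.single q 1) := by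
      rw [Matrix.mulVec_single_one (F.dd 0) c]
      rfl
    have hz : (Submodule.Quotient.mk ((F.dd 0).mulVec (Pi.single c 1)) : Mmod F) = 0 :=
      (Submodule.Quotient.mk_eq_zero _).mpr ⟨Pi.single c 1, rfl⟩
    rw [h, key2, hz, map_zero]
    rfl
  · apply Matrix.ext_of_mulVec_single
    intro q
    rw [← Matrix.mulVec_mulVec, Matrix.zero_mulVec]
    funext p
    have hz : (Submodule.Quotient.mk ((F'.dd 0).mulVec (Pi.single q 1)) : Mmod F') = 0 :=
      (Submodule.Quotient.mk_eq_zero _).mpr ⟨Pi.single q 1, rfl⟩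
    rw [key, hz, map_zero]
    rfl
  · intro v hv
    let φ0 : (Fin (F.rk 0) → PolyS K n) →ₗ[PolyS K n] PolyS K n := 
      { toFun := fun u => v ⬝ᵥ u
        map_add' := dotProduct_add v
        map_smul' := fun c u => dotProduct_smul c v u }
    have hφ0 : ∀ u, φ0 u = v ⬝ᵥ u := fun u => rfl
    let φ : Mmod F →ₗ[PolyS K n] PolyS K n := Submodule.liftQ _ φ0 (by
      rintro _ ⟨u, rfl⟩
      rw [LinearMap.mem_ker, hφ0, Matrix.mulVecLin_apply, Matrix.dotProduct_mulVec,
        ← Matrix.mulVec_transpose, hv, zero_dotProduct])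
    obtain ⟨w, hw⟩ := Submodule.Quotient.mk_surjective _ (ψ.symm φ)
    refine ⟨w, ?_⟩
    funext p
    rw [key, hw, LinearEquiv.apply_symm_apply]
    change φ0 (Pi.single p 1) = v p
    rw [hφ0]
    simp
  · intro w hw
    have h0 : ψ (Submodule.Quotient.mk w) = 0 := by
      refine LinearMap.ext fun u => ?_
      obtain ⟨u, rfl⟩ := Submodule.Quotient.mk_surjective _ u
      rw [← key2, hw]
      simp
    have h1 := ψ.map_eq_zero_iff.mp h0
    rw [Submodule.Quotient.mk_eq_zero] at h1
    exact h1

/-! ### Consequences of local duality -/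

lemma nx_iter_inl (k l : ℕ) : nx^[k] (.inl (l + k)) = .inl l := by
  induction k with
  | zero => rfl
  | succ k ih => rw [Function.iterate_succ_apply]; exact ih

lemma nx_iter_inr (k j : ℕ) : nx^[k] (.inr j) = .inr (j + k) := by
  induction k generalizing j with
  | zero => rfl
  | succ k ih =>
    rw [Function.iterate_succ_apply]
    change nx^[k] (.inr (j + 1)) = _
    rw [ih]
    congr 1
    omega

lemma nx_iter_cross (k l : ℕ) : nx^[k + 1 + l] (.inl l) = .inr k := by
  rw [Function.iterate_add_apply]
  have := nx_iter_inl l 0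
  rw [zero_add] at this
  rw [this, Function.iterate_succ_apply]
  change nx^[k] (.inr 0) = _
  rw [nx_iter_inr, zero_add]

namespace DualData

variable {F F' : FreeComplex K n} (D : DualData F F')

/-- the glued complex -/
def C : GC K n := glue F F' D.ε D.h1 D.h2 D.h3

lemma torS (hres : IsResolution F) (hres' : IsResolution F') (r : ℕ) (hvb : IsVectorBundle F r)
    (j : Fin n) : D.C.TorS j := by
  obtain ⟨N, hN⟩ := X_pow_mem_reg F r hvb
  rintro ((_ | _ | l) | k) e v hv
  · refine ⟨0, ?_⟩
    rw [pow_zero, one_smul]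
    exact D.ex1 v hv.1
  · refine ⟨0, ?_⟩
    rw [pow_zero, one_smul]
    exact D.ex0 v hv.1
  · refine ⟨N, ?_⟩
    exact ext_torsion F hres _ (hN j) l v hv.1
  · refine ⟨0, ?_⟩
    rw [pow_zero, one_smul]
    have h := hres' k
    have h2 : v ∈ LinearMap.ker ((F'.dd k).mulVecLin) := hv.1
    rw [h] at h2
    exact h2

lemma hS_inl (l : ℕ) (e : ℤ) : D.C.hS (.inl (l + 2)) e = cohomDim (dualCo F) (l + 1) e := rfl

lemma hD_inr (k : ℕ) (d : ℤ) : D.C.hD (.inr k) d = cohomDim (dualCo F') (k + 1) d := rfl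

lemma hD_inl (hres : IsResolution F) (l : ℕ) (d : ℤ) : D.C.hD (.inl (l + 2)) d = 0 := by
  apply qdim_eq_zero_of_le
  intro v hv
  have h := hres l
  have h2 : v ∈ LinearMap.ker ((F.dd l).mulVecLin) := hv.1
  rw [h] at h2
  exact h2

end DualData

lemma ext_big {m : ℕ} {F F' : FreeComplex K (m + 1)} (D : DualData F F')
    (hT : ∀ j, D.C.TorS j) (hres : IsResolution F) (i : ℕ) (hi : m + 2 ≤ i) (e : ℤ) :
    cohomDim (dualCo F) i e = 0 := by
  obtain ⟨t, rfl⟩ := Nat.exists_eq_add_of_le hi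
  have h := D.C.local_duality hT (.inl ((t + m + 1) + 2)) (d := -e - (m + 1 : ℕ)) (e := e) rfl
  rw [D.hS_inl] at h
  have e1 : (t + m + 1) + 2 = (t + 2) + (m + 1) := by omega
  rw [e1, nx_iter_inl, D.hD_inl hres] at h
  have e2 : m + 2 + t = t + m + 1 + 1 := by omega
  rw [e2, ← h]

lemma ext_mid {m : ℕ} {F F' : FreeComplex K (m + 1)} (D : DualData F F')
    (hT : ∀ j, D.C.TorS j) (k l : ℕ) (hkl : k + l + 2 = m) (e d : ℤ) (hd : d = -e - (m + 1 : ℕ)) :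
    cohomDim (dualCo F') (k + 1) d = cohomDim (dualCo F) (l + 1) e := by
  subst hkl
  have h := D.C.local_duality hT (.inl (l + 2)) hd
  rw [D.hS_inl] at h
  have e1 : nx^[k + l + 2 + 1] (.inl (l + 2)) = .inr k := by
    rw [← nx_iter_cross k (l + 2)]
    congr 1
    omega
  rw [e1, D.hD_inr] at h
  exact h

lemma ext_top {m : ℕ} {F F' : FreeComplex K (m + 1)} (D : DualData F F')
    (hT : ∀ j, D.C.TorS j) (e d : ℤ) (hd : d = -e - (m + 1 : ℕ)) :
    D.C.hD (.inl 1) d = cohomDim (dualCo F) (m + 1) e := by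
  have h := D.C.local_duality hT (.inl (m + 2)) hd
  rw [D.hS_inl] at h
  have e1 : m + 2 = 1 + (m + 1) := by omega
  rw [e1, nx_iter_inl] at h
  exact h

lemma ext_sub {m : ℕ} {F F' : FreeComplex K (m + 1)} (D : DualData F F')
    (hT : ∀ j, D.C.TorS j) (l : ℕ) (hl : m = l + 1) (e d : ℤ) (hd : d = -e - (m + 1 : ℕ)) :
    D.C.hD (.inl 0) d = cohomDim (dualCo F) (l + 1) e := by
  subst hl
  have h := D.C.local_duality hT (.inl (l + 2)) hd
  rw [D.hS_inl] at h
  have e1 : nx^[l + 1 + 1] (.inl (l + 2)) = .inl 0 := by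
    have := nx_iter_inl (l + 2) 0
    rw [zero_add] at this
    exact this
  rw [e1] at h
  exact h

namespace DualData
variable {F F' : FreeComplex K n} (D : DualData F F')

lemma MPieceDim_eq (d : ℤ) : MPieceDim F d = qdim (D.C.PD (.inl 0) d) (D.C.BD (.inl 1)) := by
  have h : D.C.PD (.inl 0) d = freePiece (F.deg 0) d := by
    unfold GC.PD
    congr 1
    funext p
    exact neg_neg _
  rw [h]
  rfl

lemma qdim_mono {X : Type*} [AddCommGroup X] [Module K X] (Z P B : Submodule K X)
    [FiniteDimensional K P] (h : Z ≤ P) : qdim Z B ≤ qdim P B := by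
  let g : (Z ⧸ Submodule.comap Z.subtype B) →ₗ[K] (P ⧸ Submodule.comap P.subtype B) :=
    Submodule.mapQ _ _ (Submodule.inclusion h) (fun z hz => hz)
  refine LinearMap.finrank_le_finrank_of_injective (f := g) ?_
  rw [← LinearMap.ker_eq_bot, eq_bot_iff]
  intro z hz
  obtain ⟨z, rfl⟩ := Submodule.Quotient.mk_surjective _ z
  rw [LinearMap.mem_ker] at hz
  change Submodule.Quotient.mk _ = _ at hz
  rw [Submodule.Quotient.mk_eq_zero] at hz
  rw [Submodule.mem_bot, Submodule.Quotient.mk_eq_zero]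
  exact hz

lemma qdim_eq_imp {X : Type*} [AddCommGroup X] [Module K X] (Z P B : Submodule K X)
    [FiniteDimensional K P] (h : Z ≤ P) (hB : B ⊓ P ≤ Z) (hle : qdim P B ≤ qdim Z B) : Z = P := by
  have : FiniteDimensional K Z := Submodule.finiteDimensional_of_le h
  have a1 := Submodule.finrank_quotient_add_finrank (Submodule.comap Z.subtype B)
  have a2 := Submodule.finrank_quotient_add_finrank (Submodule.comap P.subtype B)
  have e : finrank K (Submodule.comap Z.subtype B) = finrank K (Submodule.comap P.subtype B) := by
    rw [← Submodule.finrank_map_subtype_eq, ← Submodule.finrank_map_subtype_eq,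
      Submodule.map_comap_subtype, Submodule.map_comap_subtype]
    have : Z ⊓ B = P ⊓ B := le_antisymm (inf_le_inf_right _ h) (le_inf (inf_comm P B ▸ hB) inf_le_right)
    rw [this]
  unfold qdim at hle
  exact Submodule.eq_of_le_of_finrank_le h (by omega)

lemma hD1_le (d : ℤ) : D.C.hD (.inl 1) d ≤ MPieceDim F d := by
  rw [D.MPieceDim_eq]
  have : FiniteDimensional K (D.C.PD (.inl 0) d) := freePiece_finite _ _
  exact qdim_mono (D.C.ZD (.inl 1) d) (D.C.PD (nx (.inl 1)) d) _ inf_le_right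

lemma A0 (d : ℤ) (h0 : D.C.hD (.inl 0) d = 0) (h1 : MPieceDim F d ≤ D.C.hD (.inl 1) d) :
    cohomDim (dualCo F') 0 d = 0 := by
  have f0 : FiniteDimensional K (D.C.PD (nx (.inl 1)) d) := freePiece_finite _ _
  have f1 : FiniteDimensional K (D.C.PD (nx (.inl 0)) d) := freePiece_finite _ _
  have hZ : D.C.ZD (.inl 1) d = D.C.PD (nx (.inl 1)) d := by
    refine qdim_eq_imp _ _ (D.C.BD (.inl 1)) inf_le_right ?_ (by rw [D.MPieceDim_eq] at h1; exact h1)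
    rintro v ⟨⟨w, rfl⟩, hv⟩
    refine ⟨?_, hv⟩
    change (D.C.dd (nx (.inl 1))).transpose.mulVec ((D.C.dd (.inl 1)).transpose.mulVec w) = 0
    rw [Matrix.mulVec_mulVec, ← Matrix.transpose_mul, D.C.isComplex (.inl 1)]
    simp
  have f2 : FiniteDimensional K (D.C.ZD (.inl 0) d) :=
    Submodule.finiteDimensional_of_le (S₂ := D.C.PD (nx (.inl 0)) d) inf_le_right
  have hle := (qdim_eq_zero _ _).mp h0
  change qdim ((dualCo F').kerPiece 0 d) ((dualCo F').imSub 0) = 0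
  apply qdim_eq_zero_of_le
  intro v hv
  have hv' : v ∈ D.C.ZD (.inl 0) d := hv
  obtain ⟨w, hw⟩ := hle hv'
  obtain ⟨u, hu, hu'⟩ := exists_homog_comp (fun p => -D.C.deg (.inr 0) p)
    (fun p => -D.C.deg (.inl 0) p) (D.C.dd (.inl 0)).transpose (by
      intro p q
      have := D.C.isHomog (.inl 0) q p
      rw [neg_sub_neg]
      exact this) hv'.2 w hw
  have hu2 : u ∈ D.C.ZD (.inl 1) d := by rw [hZ]; exact hu
  have hu3 : (D.C.dd (.inl 0)).transpose.mulVec u = 0 := hu2.1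
  have : v = 0 := hu'.symm.trans hu3
  rw [this]
  exact Submodule.zero_mem _

end DualData

/-! ### Numerics -/

lemma finrank_homogZ_neg {z : ℤ} (hz : z < 0) : finrank K (homogZ K n z) = 0 := by
  have h : homogZ K n z = ⊥ := by
    simp only [homogZ, not_le.mpr hz, iSup_false]
  rw [h, finrank_bot]

lemma finrank_homogZ_nat (z : ℕ) : finrank K (homogZ K n z) = (n + z - 1).choose z := by
  have h : homogZ K n z = homogeneousSubmodule (Fin n) K z := by
    simp [homogZ]
  rw [h, homogeneousSubmodule_eq_finsupp_supported]
  have hs : {d : Fin n →₀ ℕ | d.degree = z} = ((Finset.univ : Finset (Fin n)).finsuppAntidiag z : Set _) := by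
    ext d
    simp [Finsupp.degree_eq_sum]
  rw [hs, (AddMonoidAlgebra.supportedEquivFinsupp _).finrank_eq, Module.finrank_finsupp_self,
    Set.fintypeCard_eq_ncard, Set.ncard_coe_finset, Finset.card_finsuppAntidiag_nat_eq_choose, Finset.card_univ, Fintype.card_fin]

lemma prod_eq_choose (m z : ℕ) : ((m.factorial : ℚ))⁻¹ * ∏ k ∈ Finset.range m, ((z : ℚ) + k + 1) =
    ((m + 1 + z - 1).choose z : ℕ) := by
  have h : (m + 1 + z - 1) = z + m := by omega
  rw [h]
  have h2 : ∏ k ∈ Finset.range m, ((z : ℚ) + k + 1) = ((z + 1).ascFactorial m : ℕ) := by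
    rw [Nat.ascFactorial_eq_prod_range]
    push_cast
    exact Finset.prod_congr rfl fun k _ => by ring
  rw [h2, Nat.ascFactorial_eq_factorial_mul_choose]
  push_cast
  rw [← mul_assoc, inv_mul_cancel₀ (by positivity), one_mul]
  have : (z + m).choose m = (z + m).choose z := by rw [Nat.choose_symm_add]
  rw [this]

lemma eval_genHilb (K : Type) [Field K] (m : ℕ) (a d : ℤ) : (genHilb (m + 1) a).eval (d : ℚ) =
    (finrank K (homogZ K (m + 1) (d - a)) : ℚ) +
      (-1) ^ m * (finrank K (homogZ K (m + 1) (a - d - (m + 1 : ℕ))) : ℚ) := by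
  have h0 : (genHilb (m + 1) a).eval (d : ℚ) =
      ((m.factorial : ℚ))⁻¹ * ∏ k ∈ Finset.range m, (((d - a : ℤ) : ℚ) + k + 1) := by
    simp only [genHilb, Nat.add_eq_zero_iff, one_ne_zero, and_false, if_false, Nat.add_sub_cancel,
      Polynomial.eval_mul, Polynomial.eval_C, Polynomial.eval_prod, Polynomial.eval_add,
      Polynomial.eval_sub, Polynomial.eval_X]
    congr 1
    refine Finset.prod_congr rfl fun k _ => ?_
    push_cast
    ring
  rw [h0]
  have hz : a - d - (m + 1 : ℕ) = -(d - a) - (m + 1 : ℕ) := by ring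
  rw [hz]
  generalize d - a = z
  rcases lt_or_ge z 0 with h | h
  · rw [finrank_homogZ_neg h]
    rcases lt_or_ge (-z - (m + 1 : ℕ)) 0 with h2 | h2
    · rw [finrank_homogZ_neg h2]
      have : ∏ k ∈ Finset.range m, ((z : ℚ) + k + 1) = 0 := by
        refine Finset.prod_eq_zero (i := (-z - 1).toNat) ?_ ?_
        · rw [Finset.mem_range]; push_cast at h2; omega
        · have : ((-z - 1).toNat : ℤ) = -z - 1 := Int.toNat_of_nonneg (by omega)
          have : ((-z - 1).toNat : ℚ) = -z - 1 := by exact_mod_cast this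
          rw [this]; ring
      rw [this]; simp
    · obtain ⟨w, hw⟩ := Int.eq_ofNat_of_zero_le h2
      rw [hw, finrank_homogZ_nat, ← prod_eq_choose]
      have hz : (z : ℚ) = -(w : ℚ) - m - 1 := by
        have : z = -(w : ℤ) - m - 1 := by push_cast at hw; omega
        rw [this]; push_cast; ring
      rw [← Finset.prod_range_reflect]
      have : ∏ k ∈ Finset.range m, ((z : ℚ) + (m - 1 - k : ℕ) + 1) =
          (-1) ^ m * ∏ k ∈ Finset.range m, ((w : ℚ) + k + 1) := by
        rw [← Finset.card_range m, ← Finset.prod_const, Finset.card_range, ← Finset.prod_mul_distrib]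
        refine Finset.prod_congr rfl fun k hk => ?_
        rw [Finset.mem_range] at hk
        have : ((m - 1 - k : ℕ) : ℚ) = m - 1 - k := by
          rw [Nat.cast_sub (by omega), Nat.cast_sub (by omega)]; simp
        rw [this, hz]; ring
      rw [this]; push_cast; ring
  · obtain ⟨w, rfl⟩ := Int.eq_ofNat_of_zero_le h
    rw [finrank_homogZ_neg (z := -(w : ℤ) - (m + 1 : ℕ)) (by push_cast; omega), finrank_homogZ_nat, ← prod_eq_choose]
    simp

lemma finrank_freePiece {r : ℕ} (dg : Fin r → ℤ) (e : ℤ) :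
    finrank K (freePiece dg e : Submodule K (Fin r → PolyS K n)) =
      ∑ p, finrank K (homogZ K n (e - dg p)) := by
  rw [(freePieceEquiv dg e).finrank_eq, Module.finrank_pi_fintype]

/-- rank of a matrix in a given degree -/
def rkp {r r' : ℕ} (dp : Fin r → ℤ) (A : Matrix (Fin r) (Fin r') (PolyS K n)) (e : ℤ) : ℕ :=
  finrank K ((LinearMap.range A.mulVecLin).restrictScalars K ⊓ freePiece dp e :
    Submodule K (Fin r → PolyS K n))

lemma rank_nullity {r r' : ℕ} (dp : Fin r → ℤ) (dq : Fin r' → ℤ)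
    (A : Matrix (Fin r) (Fin r') (PolyS K n)) (hA : ∀ p q, A p q ∈ homogZ K n (dq q - dp p))
    (e : ℤ) : finrank K (freePiece dq e : Submodule K (Fin r' → PolyS K n)) =
      finrank K ((LinearMap.ker A.mulVecLin).restrictScalars K ⊓ freePiece dq e :
        Submodule K (Fin r' → PolyS K n)) + rkp dp A e := by
  let f : (freePiece dq e : Submodule K (Fin r' → PolyS K n)) →ₗ[K] (Fin r → PolyS K n) :=
    (A.mulVecLin.restrictScalars K).domRestrict _
  have h := f.finrank_range_add_finrank_ker
  have h1 : LinearMap.range f = (LinearMap.range A.mulVecLin).restrictScalars K ⊓ freePiece dp e := by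
    ext v
    constructor
    · rintro ⟨⟨w, hw⟩, rfl⟩
      refine ⟨⟨w, rfl⟩, ?_⟩
      change A.mulVec w ∈ freePiece dp e
      rw [mem_freePiece] at *
      intro p
      simp only [Matrix.mulVec, dotProduct]
      refine Submodule.sum_mem _ fun q _ => ?_
      rw [← toL_mem, map_mul]
      refine SP_mul ?_ (toL_mem.mpr (hA p q)) (toL_mem.mpr (hw q))
      rintro a ⟨ha, ha'⟩ b ⟨hb, hb'⟩
      refine ⟨fun i => add_nonneg (ha i) (hb i), ?_⟩
      simp only [Pi.add_apply, Finset.sum_add_distrib, ha', hb']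
      ring
    · rintro ⟨⟨w, hw⟩, hv⟩
      obtain ⟨w', hw', h'⟩ := exists_homog_comp dp dq A hA hv w hw
      exact ⟨⟨w', hw'⟩, h'⟩
  have h2 : finrank K (LinearMap.ker f) =
      finrank K ((LinearMap.ker A.mulVecLin).restrictScalars K ⊓ freePiece dq e :
        Submodule K (Fin r' → PolyS K n)) := by
    have h3 : Submodule.map (freePiece dq e).subtype (LinearMap.ker f) =
        (LinearMap.ker A.mulVecLin).restrictScalars K ⊓ freePiece dq e := by
      ext v
      constructor
      · rintro ⟨w, hw, rfl⟩
        exact ⟨hw, w.2⟩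
      · rintro ⟨hw, hv⟩
        exact ⟨⟨v, hv⟩, hw, rfl⟩
    rw [← Submodule.finrank_map_subtype_eq, h3]
  rw [← h, h1, h2, rkp, add_comm]

lemma qdim_add_inf {X : Type*} [AddCommGroup X] [Module K X] (Z B : Submodule K X)
    [FiniteDimensional K Z] : qdim Z B + finrank K (B ⊓ Z : Submodule K X) = finrank K Z := by
  have a1 := Submodule.finrank_quotient_add_finrank (Submodule.comap Z.subtype B)
  rw [← Submodule.finrank_map_subtype_eq, Submodule.map_comap_subtype, inf_comm] at a1
  exact a1

lemma alt_sum (g N ρ : ℕ → ℚ) (h0 : g 0 = N 0 + ρ 0)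
    (hs : ∀ i, g (i + 1) = N (i + 1) + ρ i + ρ (i + 1)) (L : ℕ) :
    ∑ i ∈ Finset.range (L + 1), (-1) ^ i * g i =
      ∑ i ∈ Finset.range (L + 1), (-1) ^ i * N i + (-1) ^ L * ρ L := by
  induction L with
  | zero => simp [h0]
  | succ L ih =>
    rw [Finset.sum_range_succ, ih, Finset.sum_range_succ _ (L + 1), hs]
    ring

lemma rkp_zero {r r' : ℕ} (dp : Fin r → ℤ) (A : Matrix (Fin r) (Fin r') (PolyS K n)) (e : ℤ)
    (h : r' = 0 ∨ r = 0) : rkp dp A e = 0 := by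
  have : (LinearMap.range A.mulVecLin).restrictScalars K = ⊥ := by
    rw [eq_bot_iff]
    rintro v ⟨w, rfl⟩
    rw [Submodule.mem_bot]
    rcases h with h | h
    · subst h
      have : w = 0 := funext fun q => Fin.elim0 q
      rw [this, map_zero]
    · subst h
      exact funext fun q => Fin.elim0 q
  rw [rkp, this, bot_inf_eq, finrank_bot]

lemma alt_F (F : FreeComplex K n) (hres : IsResolution F) (d : ℤ) :
    ∑ i ∈ Finset.range (F.len + 1), (-1 : ℚ) ^ i *
      (finrank K (freePiece (F.deg i) d : Submodule K (Fin (F.rk i) → PolyS K n)) : ℚ) =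
    MPieceDim F d := by
  rw [alt_sum _ (fun i => if i = 0 then (MPieceDim F d : ℚ) else 0)
    (fun i => (rkp (F.deg i) (F.dd i) d : ℚ))]
  · rw [rkp_zero _ _ _ (Or.inl (F.rk_eq_zero _ (Nat.lt_succ_self _)))]
    simp
  · have := qdim_add_inf (freePiece (F.deg 0) d)
      ((LinearMap.range ((F.dd 0).mulVecLin)).restrictScalars K)
    rw [← this]
    push_cast
    rfl
  · intro i
    have := rank_nullity (F.deg i) (F.deg (i + 1)) (F.dd i) (F.isHomog i) d
    rw [hres i] at this
    rw [this]
    simp only [Nat.add_eq_zero_iff, one_ne_zero, and_false, if_false, rkp]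
    push_cast
    ring

lemma alt_E (F : FreeComplex K n) (e : ℤ) :
    ∑ i ∈ Finset.range (F.len + 1), (-1 : ℚ) ^ i *
      (finrank K (freePiece (fun p => -F.deg i p) e : Submodule K (Fin (F.rk i) → PolyS K n)) : ℚ) =
    ∑ i ∈ Finset.range (F.len + 1), (-1 : ℚ) ^ i * (cohomDim (dualCo F) i e : ℚ) := by
  have hrn : ∀ i, finrank K (freePiece (fun p => -F.deg i p) e : Submodule K (Fin (F.rk i) → PolyS K n)) =
      finrank K ((dualCo F).kerPiece i e) + rkp ((dualCo F).deg (i + 1)) ((dualCo F).dd i) e := fun i =>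
    rank_nullity ((dualCo F).deg (i + 1)) ((dualCo F).deg i) ((dualCo F).dd i) ((dualCo F).isHomog i) e
  have hfin : ∀ i, FiniteDimensional K ((dualCo F).kerPiece i e) := fun i =>
    Submodule.finiteDimensional_of_le (S₂ := freePiece ((dualCo F).deg i) e) inf_le_right
  have hq : ∀ i, cohomDim (dualCo F) i e + finrank K ((dualCo F).imSub i ⊓ (dualCo F).kerPiece i e :
      Submodule K (Fin ((dualCo F).rk i) → PolyS K n)) = finrank K ((dualCo F).kerPiece i e) := fun i =>
    qdim_add_inf _ _
  rw [alt_sum _ (fun i => (cohomDim (dualCo F) i e : ℚ))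
    (fun i => (rkp ((dualCo F).deg (i + 1)) ((dualCo F).dd i) e : ℚ))]
  · have h0 : rkp ((dualCo F).deg (F.len + 1)) ((dualCo F).dd F.len) e = 0 :=
      rkp_zero _ _ _ (Or.inr (F.rk_eq_zero _ (Nat.lt_succ_self _)))
    rw [h0]
    simp
  · rw [hrn, ← hq]
    have : (dualCo F).imSub 0 = ⊥ := rfl
    rw [this, bot_inf_eq, finrank_bot]
    push_cast
    ring
  · intro i
    rw [hrn, ← hq]
    have : (dualCo F).imSub (i + 1) ⊓ (dualCo F).kerPiece (i + 1) e =
        (LinearMap.range ((dualCo F).dd i).mulVecLin).restrictScalars K ⊓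
          freePiece ((dualCo F).deg (i + 1)) e := by
      ext v
      constructor
      · rintro ⟨h1, h2⟩
        exact ⟨h1, h2.2⟩
      · rintro ⟨⟨w, rfl⟩, h2⟩
        refine ⟨⟨w, rfl⟩, ?_, h2⟩
        change ((dualCo F).dd (i + 1)).mulVec (((dualCo F).dd i).mulVec w) = 0
        rw [Matrix.mulVec_mulVec, (dualCo F).isComplex, Matrix.zero_mulVec]
    rw [this]
    simp only [rkp]
    push_cast
    ring

lemma eval_hilbPoly {m : ℕ} (F : FreeComplex K (m + 1)) (hres : IsResolution F) (d : ℤ) :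
    (hilbPoly F).eval (d : ℚ) = MPieceDim F d + (-1) ^ m *
      ∑ i ∈ Finset.range (F.len + 1), (-1 : ℚ) ^ i * (cohomDim (dualCo F) i (-d - (m + 1 : ℕ)) : ℚ) := by
  rw [← alt_F F hres, ← alt_E, Finset.mul_sum, ← Finset.sum_add_distrib]
  rw [hilbPoly, Polynomial.eval_finsetSum]
  refine Finset.sum_congr rfl fun i _ => ?_
  rw [Polynomial.eval_mul, Polynomial.eval_C, Polynomial.eval_finsetSum, finrank_freePiece,
    finrank_freePiece]
  simp only [eval_genHilb K]
  rw [Finset.sum_add_distrib, ← Finset.mul_sum]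
  have : ∀ p, F.deg i p - d - (m + 1 : ℕ) = -d - (m + 1 : ℕ) - -F.deg i p := fun p => by ring
  have hh : ∀ p, finrank K (homogZ K (m + 1) (F.deg i p - d - (m + 1 : ℕ))) =
      finrank K (homogZ K (m + 1) (-d - (m + 1 : ℕ) - -F.deg i p)) := fun p => by rw [this p]
  simp only [hh]
  push_cast
  ring

lemma cohomDim_gt (F : FreeComplex K n) (i : ℕ) (hi : F.len < i) (e : ℤ) :
    cohomDim (dualCo F) i e = 0 := by
  apply qdim_eq_zero_of_le
  intro v _
  have h : (dualCo F).rk i = 0 := F.rk_eq_zero i hi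
  have : v = 0 := funext fun q => Fin.elim0 (h ▸ q)
  rw [this]
  exact Submodule.zero_mem _

/-! ### The vanishing at roots and the conclusion -/

lemma sheafH_zero {m : ℕ} (F : FreeComplex K (m + 1)) (d : ℤ) :
    sheafH F 0 d = MPieceDim F d - cohomDim (dualCo F) (m + 1) (-d - (m + 1 : ℕ)) +
      cohomDim (dualCo F) m (-d - (m + 1 : ℕ)) := by
  have h1 : ((m + 1 : ℕ) : ℤ) - 1 = (m : ℤ) := by push_cast; ring
  simp only [sheafH, if_true, extDim, h1, Int.natCast_nonneg, Int.toNat_natCast]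

lemma sheafH_pos {m : ℕ} (F : FreeComplex K (m + 1)) (i j : ℕ) (hi : 1 ≤ i) (hij : i + j = m)
    (d : ℤ) : sheafH F i d = cohomDim (dualCo F) j (-d - (m + 1 : ℕ)) := by
  have h1 : ((m + 1 : ℕ) : ℤ) - 1 - i = (j : ℤ) := by push_cast; omega
  have h2 : i ≠ 0 := by omega
  simp only [sheafH, h2, if_false, extDim, h1, Int.natCast_nonneg, if_true, Int.toNat_natCast]

lemma sheafH_gt {m : ℕ} (F : FreeComplex K (m + 1)) (i : ℕ) (hij : m < i)
    (d : ℤ) : sheafH F i d = 0 := by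
  have h1 : ¬ (0 ≤ ((m + 1 : ℕ) : ℤ) - 1 - i) := by push_cast; omega
  have h2 : i ≠ 0 := by omega
  simp only [sheafH, h2, if_false, extDim, h1]

lemma sum_range_eq (f : ℕ → ℚ) (a b : ℕ) (ha : ∀ i, a ≤ i → f i = 0) (hb : ∀ i, b ≤ i → f i = 0) :
    ∑ i ∈ Finset.range a, f i = ∑ i ∈ Finset.range b, f i := by
  have h : ∀ c, (∀ i, c ≤ i → f i = 0) → c ≤ max a b →
      ∑ i ∈ Finset.range c, f i = ∑ i ∈ Finset.range (max a b), f i := by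
    intro c hc hle
    refine Finset.sum_subset (Finset.range_mono hle) fun i _ hi => hc i ?_
    simpa using hi
  rw [h a ha (le_max_left _ _), h b hb (le_max_right _ _)]

lemma root_vanish {m : ℕ} (F : FreeComplex K (m + 1)) (hres : IsResolution F)
    (hbig : ∀ i, m + 2 ≤ i → ∀ e, cohomDim (dualCo F) i e = 0)
    (hle : ∀ d, cohomDim (dualCo F) (m + 1) (-d - (m + 1 : ℕ)) ≤ MPieceDim F d)
    (hnat : HasNaturalCohomology F) (d : ℤ) (h0 : (hilbPoly F).eval (d : ℚ) = 0) :
    (∀ i, i ≤ m → cohomDim (dualCo F) i (-d - (m + 1 : ℕ)) = 0) ∧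
      MPieceDim F d ≤ cohomDim (dualCo F) (m + 1) (-d - (m + 1 : ℕ)) := by
  rw [eval_hilbPoly F hres, sum_range_eq _ (F.len + 1) (m + 2)
    (fun i hi => by rw [cohomDim_gt F i hi]; simp) (fun i hi => by rw [hbig i hi]; simp)] at h0
  have hs0 := sheafH_zero F d
  have hsp := fun i j hi hij => sheafH_pos F i j hi hij d
  have hle' := hle d
  have hn := hnat d
  generalize (-d - (m + 1 : ℕ) : ℤ) = e at *
  generalize hN : (fun i => cohomDim (dualCo F) i e) = N at *
  have hN' : ∀ i, cohomDim (dualCo F) i e = N i := fun i => by rw [← hN]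
  simp only [hN'] at *
  generalize MPieceDim F d = M at *
  clear hN hN'
  rw [Finset.sum_range_succ, Finset.sum_range_succ] at h0
  have hsq : ((-1 : ℚ) ^ m) * (-1) ^ m = 1 := by
    rw [← mul_pow]; simp
  have hT : (M : ℚ) - N (m + 1) + N m + (-1) ^ m * ∑ i ∈ Finset.range m, (-1) ^ i * (N i : ℚ) = 0 := by
    rw [← h0, pow_succ]
    linear_combination ((N (m + 1) : ℚ) - N m) * hsq
  have hlow : ∀ i, i < m → N i = 0 := by
    intro i hi
    by_contra hne
    have e1 : ∀ i', i' < m → i' ≠ i → N i' = 0 := by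
      intro i' hi' hne'
      by_contra h
      have := hn (m - i) (m - i') (by rw [hsp (m - i) i (by omega) (by omega)]; exact hne)
        (by rw [hsp (m - i') i' (by omega) (by omega)]; exact h)
      omega
    have e2 : sheafH F 0 d = 0 := by
      by_contra h
      have := hn (m - i) 0 (by rw [hsp (m - i) i (by omega) (by omega)]; exact hne) h
      omega
    rw [hs0] at e2
    have e3 : M = N (m + 1) := by omega
    have e4 : N m = 0 := by omega
    rw [Finset.sum_eq_single i (fun i' h1 h2 => by rw [e1 i' (Finset.mem_range.mp h1) h2]; simp)
      (fun h => absurd (Finset.mem_range.mpr hi) h), e3, e4] at hT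
    simp at hT
    exact hne hT
  have hsum : ∑ i ∈ Finset.range m, (-1) ^ i * (N i : ℚ) = 0 :=
    Finset.sum_eq_zero fun i hi => by rw [hlow i (Finset.mem_range.mp hi)]; simp
  rw [hsum, mul_zero, add_zero] at hT
  have hT' : (M : ℤ) - N (m + 1) + N m = 0 := by exact_mod_cast hT
  refine ⟨fun i hi => ?_, by omega⟩
  rcases Nat.lt_or_ge i m with h | h
  · exact hlow i h
  · have : i = m := by omega
    subst this
    omega

lemma count_claim {m : ℕ} (F' : FreeComplex K (m + 1)) (R : Finset ℤ)
    (hR : ∀ d ∈ R, ∀ j, j < m → cohomDim (dualCo F') j d = 0) (Z : ℤ) (hZ : ∀ x ∈ R, x ≤ Z) (t : ℕ) :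
    ∀ (d : ℤ) (j : ℕ), Z - d ≤ t → j < m → cohomDim (dualCo F') j d ≠ 0 →
      (R.filter (fun x => d < x)).card ≤ j := by
  induction t with
  | zero =>
    intro d j hd hj _
    rw [Finset.filter_eq_empty_iff.mpr]
    · simp
    · intro x hx h
      have := hZ x hx
      push_cast at hd
      omega
  | succ t ih =>
    intro d j hd hj h
    obtain ⟨k, l, hkl, h'⟩ := ext_right_move F' j (by omega) d h
    have hk : k < m := by omega
    have h1 := ih (d + 1 + l) k (by push_cast at hd; omega) hk h'
    have hnot : d + 1 + l ∉ R := fun hmem => h' (hR _ hmem k hk)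
    have hsub : R.filter (fun x => d < x) ⊆ R.filter (fun x => d + 1 + l < x) ∪ Finset.Ioo d (d + 1 + l) := by
      intro x hx
      rw [Finset.mem_filter] at hx
      rw [Finset.mem_union, Finset.mem_filter, Finset.mem_Ioo]
      rcases lt_trichotomy x (d + 1 + l) with h | h | h
      · exact Or.inr ⟨hx.2, h⟩
      · exact absurd (h ▸ hx.1) hnot
      · exact Or.inl ⟨hx.1, h⟩
    have h2 := (Finset.card_le_card hsub).trans (Finset.card_union_le _ _)
    rw [Int.card_Ioo] at h2
    omega

lemma final_count {m : ℕ} (F' : FreeComplex K (m + 1)) (R : Finset ℤ) (hcard : R.card = m)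
    (hR : ∀ d ∈ R, ∀ j, j < m → cohomDim (dualCo F') j d = 0) (d : ℤ) (j : ℕ) (hj : j < m)
    (hd : ∀ x ∈ R, d + j < x + m) : cohomDim (dualCo F') j d = 0 := by
  by_contra h
  have hne : R.Nonempty := by rw [← Finset.card_pos]; omega
  have h1 := count_claim F' R hR (R.max' hne) (fun x hx => R.le_max' x hx) (R.max' hne - d).toNat d j
    (Int.self_le_toNat _) hj h
  have hnot : d ∉ R := fun hmem => h (hR _ hmem j hj)
  have hsub : R ⊆ R.filter (fun x => d < x) ∪ Finset.Ico (R.min' hne) d := by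
    intro x hx
    rw [Finset.mem_union, Finset.mem_filter, Finset.mem_Ico]
    rcases lt_trichotomy x d with h | h | h
    · exact Or.inr ⟨R.min'_le x hx, h⟩
    · exact absurd (h ▸ hx) hnot
    · exact Or.inl ⟨hx, h⟩
  have h2 := (Finset.card_le_card hsub).trans (Finset.card_union_le _ _)
  rw [Int.card_Ico] at h2
  have h3 := hd _ (R.min'_mem hne)
  omega

theorem main_aux (K : Type) [Field K] (m : ℕ)
    (F : FreeComplex K (m + 1)) (r : ℕ)
    (hres : IsResolution F) (hvb : IsVectorBundle F r)
    (z : Fin m → ℤ) (hsn : IsSupernaturalWithRoots F z)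
    (a : ℤ) (ha : ∀ j : Fin m, -(z j) - m ≤ a)
    (F' : FreeComplex K (m + 1)) (hres' : IsResolution F')
    (ψ : Mmod F' ≃ₗ[PolyS K (m + 1)] (Mmod F →ₗ[PolyS K (m + 1)] PolyS K (m + 1)))
    (hψ : ∀ e : ℤ, (MpieceIm F' e).map ((ψ.restrictScalars K).toLinearMap) = dualPiece F e) :
    ∀ i : ℕ, 1 ≤ i → sheafH F' i (a - i) = 0 := by
  intro i hi
  rcases Nat.lt_or_ge m i with him | him
  · exact sheafH_gt F' i him _
  obtain ⟨hanti, hnat, c, hc, hpoly⟩ := hsn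
  let D := mkDualData F F' ψ hψ
  have hT : ∀ j, D.C.TorS j := D.torS hres hres' r hvb
  obtain ⟨j, rfl⟩ := Nat.exists_eq_add_of_le him
  rw [sheafH_pos F' i j hi rfl]
  refine final_count F' (Finset.univ.image z) ?_ ?_ _ j (by omega) ?_
  · rw [Finset.card_image_of_injective _ hanti.injective, Finset.card_univ, Fintype.card_fin]
  · intro d hd k hk
    obtain ⟨q, -, rfl⟩ := Finset.mem_image.mp hd
    have h0 : (hilbPoly F).eval ((z q : ℤ) : ℚ) = 0 := by
      rw [hpoly, Polynomial.eval_mul, Polynomial.eval_prod,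
        Finset.prod_eq_zero (Finset.mem_univ q) (by simp), mul_zero]
    have hneg : ∀ d : ℤ, d = -(-d - (i + j + 1 : ℕ)) - (i + j + 1 : ℕ) := fun d => by ring
    obtain ⟨hv, hM⟩ := root_vanish F hres (fun i hi e => ext_big D hT hres i hi e)
      (fun d => by rw [← ext_top D hT _ d (hneg d)]; exact D.hD1_le d) hnat (z q) h0
    rcases k with _ | k
    · refine D.A0 _ ?_ ?_
      · rw [ext_sub D hT (i + j - 1) (by omega) _ _ (hneg _)]
        exact hv _ (by omega)
      · rw [ext_top D hT _ _ (hneg _)]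
        exact hM
    · rw [ext_mid D hT k (i + j - k - 2) (by omega) _ _ (hneg _)]
      exact hv _ (by omega)
  · intro x hx
    obtain ⟨q, -, rfl⟩ := Finset.mem_image.mp hx
    have := ha q
    push_cast at this ⊢
    omega

/-- Let `𝓔` be a vector bundle on `ℙ^m` (associated to
`M = coker (F₁ → F₀)`) with supernatural cohomology whose Hilbert polynomial has
roots `z_1 > ⋯ > z_m`, and let `a ≥ -z_m - m` (equivalently, `a ≥ -z_j - m` for
all `j`). Then the dual bundle `𝓔^* = Hom(𝓔, O)` — represented by any module
`coker (F'₁ → F'₀)` that is graded-isomorphic to `Hom_S(M, S)` — is `a`-regular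
in the sense of Castelnuovo–Mumford: `h^i(𝓔^*(a - i)) = 0` for all `i ≥ 1`. -/
theorem supernatural_dual_regular (K : Type) [Field K] (m : ℕ)
    (F : FreeComplex K (m + 1)) (r : ℕ)
    (hres : IsResolution F) (hvb : IsVectorBundle F r)
    (z : Fin m → ℤ) (hsn : IsSupernaturalWithRoots F z)
    (a : ℤ) (ha : ∀ j : Fin m, -(z j) - m ≤ a)
    (F' : FreeComplex K (m + 1)) (hres' : IsResolution F')
    (ψ : Mmod F' ≃ₗ[PolyS K (m + 1)] (Mmod F →ₗ[PolyS K (m + 1)] PolyS K (m + 1)))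
    (hψ : ∀ e : ℤ, (MpieceIm F' e).map ((ψ.restrictScalars K).toLinearMap) = dualPiece F e) :
    ∀ i : ℕ, 1 ≤ i → sheafH F' i (a - i) = 0 := by
  exact main_aux K m F r hres hvb z hsn a ha F' hres' ψ hψ

end
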